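/- arXiv:2412.05750 — 2 statements merged into one kernel-verified Lean document; each statement's English description precedes it below -/
import Mathlib

section
/- Let x ≥ 3 be odd, let t ≥ 2, and let L = {1^a, x^b, (tx)^c} be a multiset of size v − 1 = a + b + c with v ≥ (t+2)x. Write v = qx + r with 0 ≤ r < x and set s = ⌊q/(2t)⌋. Suppose a ≥ ω(x, b+c). Then L has a standard linear realization if any one of the following holds: (1) r is even and b ≥ tx; (2) r and t are both odd and b ≥ tx + 2t − 3; (3) r is odd, t is even and b ≥ 4s + tx + 4t − 9. -/
/-- The multiset of absolute differences of consecutive entries of a list of naturals. -/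
def linDiffs (l : List ℕ) : Multiset ℕ :=
  ↑(List.zipWith (fun a b => (a - b) + (b - a)) l l.tail)

/-- `l` is a linear realization of the multiset `L`: it lists `0, …, |L|`
(each exactly once) and its consecutive absolute differences form `L`. -/
def IsLinearRealization (L : Multiset ℕ) (l : List ℕ) : Prop :=
  l.Perm (List.range (Multiset.card L + 1)) ∧ linDiffs l = L

def HasLinearRealization (L : Multiset ℕ) : Prop :=
  ∃ l : List ℕ, IsLinearRealization L l

/-- A standard linear realization starts at `0`. -/
def HasStandardLinearRealization (L : Multiset ℕ) : Prop :=
  ∃ l : List ℕ, IsLinearRealization L l ∧ l.head? = some 0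

/-- A perfect linear realization starts at `0` and ends at `v - 1 = |L|`. -/
def HasPerfectLinearRealization (L : Multiset ℕ) : Prop :=
  ∃ l : List ℕ, IsLinearRealization L l ∧ l.head? = some 0 ∧
    l.getLast? = some (Multiset.card L)

/-- The multiset of cyclic edge-lengths `min(|gᵢ₊₁ - gᵢ|, v - |gᵢ₊₁ - gᵢ|)`
of consecutive entries of a list of naturals. -/
def cycDiffs (v : ℕ) (l : List ℕ) : Multiset ℕ :=
  ↑(List.zipWith (fun a b => min ((a - b) + (b - a)) (v - ((a - b) + (b - a)))) l l.tail)

/-- `L` is (cyclically) realizable in `K_v`: some Hamiltonian path on the vertex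
set `{0, …, v-1}` has `L` as its multiset of edge-lengths. -/
def IsRealizable (v : ℕ) (L : Multiset ℕ) : Prop :=
  ∃ l : List ℕ, l.Perm (List.range v) ∧ cycDiffs v l = L

/-- The multiset `{1^a, x^b, y^c}`. -/
def mset3 (a b c x y : ℕ) : Multiset ℕ :=
  Multiset.replicate a 1 + Multiset.replicate b x + Multiset.replicate c y

/-- With `b = q'x + r'`, `0 ≤ r' < x`: `ω(x,b) = x - 1` if `q' = 0`, `r' = 1`,
or at least one of `x`, `r'` is even; otherwise `ω(x,b) = x`. -/
def omegaBHR (x b : ℕ) : ℕ :=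
  if b / x = 0 ∨ b % x = 1 ∨ Even x ∨ Even (b % x) then x - 1 else x

/-- The reduced form `ĝ = min(g, v - g)`. -/
def reducedForm (v g : ℕ) : ℕ := min g (v - g)

/-- The function `f` of Theorem 3.7 (counterexample characterization refined). -/
def fBHR (u w : ℕ) : ℕ :=
  if Even u ∧ Even w then w - 1
  else if u = 3 ∨ (Even u ∧ ¬ Even w) then u + w - 2
  else u + w - 1

/-- A multiset `L` of size `v - 1` with elements in `{1, …, ⌊v/2⌋}` is admissible
if for every divisor `d` of `v` the number of elements of `L` divisible by `d`
is at most `v - d`. -/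
def IsAdmissible (v : ℕ) (L : Multiset ℕ) : Prop :=
  Multiset.card L = v - 1 ∧ (∀ z ∈ L, 1 ≤ z ∧ z ≤ v / 2) ∧
  ∀ d : ℕ, d ∣ v → Multiset.card (L.filter (fun z => d ∣ z)) ≤ v - d

/-! ### Paths with prescribed ends, vertices and differences -/

theorem linDiffs_cons_cons (a b : ℕ) (l : List ℕ) :
    linDiffs (a :: b :: l) = {(a - b) + (b - a)} + linDiffs (b :: l) := by
  simp [linDiffs]

theorem linDiffs_append {l₁ l₂ : List ℕ} {e s : ℕ} (h₁ : l₁.getLast? = some e)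
    (h₂ : l₂.head? = some s) :
    linDiffs (l₁ ++ l₂) = linDiffs l₁ + linDiffs l₂ + {(e - s) + (s - e)} := by
  induction l₁ with
  | nil => simp at h₁
  | cons a l ih =>
    cases l with
    | nil =>
      cases l₂ with
      | nil => simp at h₂
      | cons b l' =>
        simp only [List.getLast?_singleton, Option.some.injEq] at h₁
        simp only [List.head?_cons, Option.some.injEq] at h₂
        subst h₁ h₂
        simp only [List.cons_append, List.nil_append, linDiffs_cons_cons]
        simp [linDiffs, add_comm]
    | cons b l =>
      rw [List.getLast?_cons_cons] at h₁
      have := ih h₁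
      simp only [List.cons_append] at this ⊢
      rw [linDiffs_cons_cons, this, linDiffs_cons_cons]
      simp only [add_assoc]

theorem linDiffs_reverse (l : List ℕ) : linDiffs l.reverse = linDiffs l := by
  induction l with
  | nil => rfl
  | cons a l ih =>
    cases l with
    | nil => rfl
    | cons b l =>
      rw [List.reverse_cons, linDiffs_append (e := b) (s := a) (by simp) (by simp), ih,
        linDiffs_cons_cons]
      have : linDiffs [a] = 0 := rfl
      rw [this, add_zero, add_comm, add_comm (a - b)]

theorem linDiffs_map (x k : ℕ) (l : List ℕ) :
    linDiffs (l.map fun i => x * i + k) = (linDiffs l).map (x * ·) := by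
  induction l with
  | nil => rfl
  | cons a l ih =>
    cases l with
    | nil => rfl
    | cons b l =>
      simp only [List.map_cons] at ih ⊢
      rw [linDiffs_cons_cons, linDiffs_cons_cons, ih, Multiset.map_add, Multiset.map_singleton,
        Nat.add_sub_add_right, Nat.add_sub_add_right, ← Nat.mul_sub, ← Nat.mul_sub, ← mul_add]

/-- There is a path from `s` to `e` through the vertices `S` with differences `D`. -/
def IsPath (s e : ℕ) (S D : Multiset ℕ) : Prop :=
  ∃ l : List ℕ, (l : Multiset ℕ) = S ∧ l.head? = some s ∧ l.getLast? = some e ∧ linDiffs l = D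

theorem IsPath.single (s : ℕ) : IsPath s s {s} 0 :=
  ⟨[s], rfl, rfl, rfl, rfl⟩

theorem IsPath.reverse {s e : ℕ} {S D : Multiset ℕ} (h : IsPath s e S D) : IsPath e s S D := by
  obtain ⟨l, h₁, h₂, h₃, h₄⟩ := h
  exact ⟨l.reverse, by simpa using h₁, by simpa using h₃, by simpa using h₂,
    by rw [linDiffs_reverse, h₄]⟩

theorem IsPath.append {s e s' e' d : ℕ} {S S' D D' : Multiset ℕ} (h : IsPath s e S D)
    (h' : IsPath s' e' S' D') (hd : e + d = s' ∨ s' + d = e) :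
    IsPath s e' (S + S') (D + D' + {d}) := by
  obtain ⟨l, h₁, h₂, h₃, h₄⟩ := h
  obtain ⟨l', h₁', h₂', h₃', h₄'⟩ := h'
  refine ⟨l ++ l', by rw [← h₁, ← h₁']; rfl, ?_, ?_, ?_⟩
  · rw [List.head?_append, h₂]; rfl
  · rw [List.getLast?_append, h₃']; rfl
  · rw [linDiffs_append h₃ h₂', h₄, h₄']
    congr 2
    omega

theorem IsPath.map {s e : ℕ} {S D : Multiset ℕ} (h : IsPath s e S D) (x k : ℕ) :
    IsPath (x * s + k) (x * e + k) (S.map fun i => x * i + k) (D.map (x * ·)) := by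
  obtain ⟨l, h₁, h₂, h₃, h₄⟩ := h
  refine ⟨l.map fun i => x * i + k, by rw [← h₁]; rfl, ?_, ?_, by rw [linDiffs_map, h₄]⟩
  · rw [List.head?_map, h₂]; rfl
  · rw [List.getLast?_map, h₃]; rfl

theorem IsPath.card {s e : ℕ} {S D : Multiset ℕ} (h : IsPath s e S D) :
    Multiset.card S = Multiset.card D + 1 := by
  obtain ⟨l, rfl, h₂, -, rfl⟩ := h
  cases l with
  | nil => simp at h₂
  | cons a l => simp [linDiffs]

/-! ### Paths with differences `1`, `t` -/

/-- There is a path from `s` to `e` through `S` with `j` differences `t`, the others being `1`. -/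
def StepPath (t s e : ℕ) (S : Multiset ℕ) (j : ℕ) : Prop :=
  ∃ i, IsPath s e S (Multiset.replicate i 1 + Multiset.replicate j t)

namespace StepPath

variable {t s e s' e' j j' : ℕ} {S S' : Multiset ℕ}

theorem single (t s : ℕ) : StepPath t s s {s} 0 := ⟨0, IsPath.single s⟩

theorem reverse (h : StepPath t s e S j) : StepPath t e s S j := h.imp fun _ h => h.reverse

theorem append (h : StepPath t s e S j) (h' : StepPath t s' e' S' j')
    (hd : e + 1 = s' ∨ s' + 1 = e) : StepPath t s e' (S + S') (j + j') := by
  obtain ⟨i, h⟩ := h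
  obtain ⟨i', h'⟩ := h'
  refine ⟨i + i' + 1, ?_⟩
  convert h.append h' hd using 1
  simp only [Multiset.replicate_add, Multiset.replicate_one]
  ac_rfl

theorem append_long (h : StepPath t s e S j) (h' : StepPath t s' e' S' j')
    (hd : e + t = s' ∨ s' + t = e) : StepPath t s e' (S + S') (j + j' + 1) := by
  obtain ⟨i, h⟩ := h
  obtain ⟨i', h'⟩ := h'
  refine ⟨i + i', ?_⟩
  convert h.append h' hd using 1
  simp only [Multiset.replicate_add, Multiset.replicate_one]
  ac_rfl

theorem shift (h : StepPath t s e S j) : StepPath t (s + 1) (e + 1) (S.map (· + 1)) j := by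
  obtain ⟨i, h⟩ := h
  exact ⟨i, by simpa using h.map 1 1⟩

theorem cons (h : StepPath t 0 e S j) : StepPath t 0 (e + 1) ({0} + S.map (· + 1)) j := by
  simpa using (single t 0).append h.shift (by simp)

theorem range_succ_eq (n : ℕ) :
    Multiset.range (n + 1) = {0} + (Multiset.range n).map (· + 1) := by
  induction n with
  | zero => rfl
  | succ n ih =>
    conv_lhs => rw [Multiset.range_succ, ih]
    rw [Multiset.range_succ, Multiset.map_cons]
    simp only [← Multiset.singleton_add]
    ac_rfl

theorem straight (t n : ℕ) : StepPath t 0 n (Multiset.range (n + 1)) 0 := by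
  induction n with
  | zero => exact single t 0
  | succ n ih => rw [range_succ_eq]; exact ih.cons

theorem cons_range {n : ℕ} (h : StepPath t 0 e (Multiset.range n) j) :
    StepPath t 0 (e + 1) (Multiset.range (n + 1)) j := by
  rw [range_succ_eq]; exact h.cons

theorem cons_range_of_le {n n' : ℕ} (h : StepPath t 0 e (Multiset.range n) j) (hn : n ≤ n') :
    StepPath t 0 (e + (n' - n)) (Multiset.range n') j := by
  induction n', hn using Nat.le_induction with
  | base => simpa using h
  | succ n' hn ih =>
    have := ih.cons_range
    rwa [add_assoc, ← Nat.sub_add_comm hn] at this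

end StepPath

/-! ### Paths with differences `1`, `x`, `t * x` -/

/-- There is a path from `s` to `e` through `S` with `a` differences `1` and `c` differences
`t * x`, the others being `x`. -/
def ClassPath (x t s e : ℕ) (S : Multiset ℕ) (a c : ℕ) : Prop :=
  ∃ b, IsPath s e S (mset3 a b c x (t * x))

/-- The numbers `x * i + k` with `i < n`. -/
def cls (x k n : ℕ) : Multiset ℕ := (Multiset.range n).map fun i => x * i + k

/-- The numbers `x * i + k` with `i < n` and `k₁ ≤ k < k₂`. -/
def clsIco (x n k₁ k₂ : ℕ) : Multiset ℕ := ∑ k ∈ Finset.Ico k₁ k₂, cls x k n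

theorem clsIco_self (x n k : ℕ) : clsIco x n k k = 0 := by simp [clsIco]

theorem clsIco_one (x n k : ℕ) : clsIco x n k (k + 1) = cls x k n := by simp [clsIco]

theorem clsIco_add {x n k₁ k₂ k₃ : ℕ} (h₁ : k₁ ≤ k₂) (h₂ : k₂ ≤ k₃) :
    clsIco x n k₁ k₂ + clsIco x n k₂ k₃ = clsIco x n k₁ k₃ :=
  Finset.sum_Ico_consecutive _ h₁ h₂

theorem clsIco_succ {x n k₁ k₂ : ℕ} (h : k₁ ≤ k₂) :
    clsIco x n k₁ (k₂ + 1) = clsIco x n k₁ k₂ + cls x k₂ n := by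
  rw [← clsIco_one, clsIco_add h (by omega)]

theorem clsIco_cons {x n k₁ k₂ : ℕ} (h : k₁ < k₂) :
    clsIco x n k₁ k₂ = cls x k₁ n + clsIco x n (k₁ + 1) k₂ := by
  rw [← clsIco_one, clsIco_add (by omega) h]

theorem cls_one (x k : ℕ) : cls x k 1 = {k} := by simp [cls]

theorem cls_succ (x k n : ℕ) : cls x k (n + 1) = cls x k n + {x * n + k} := by
  simp [cls, Multiset.range_succ, ← Multiset.singleton_add, add_comm]

theorem range_add_eq (m n : ℕ) :
    Multiset.range (m + n) = Multiset.range m + ∑ k ∈ Finset.range n, {m + k} := by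
  induction n with
  | zero => simp
  | succ n ih =>
    rw [← add_assoc, Multiset.range_succ, ih, Finset.sum_range_succ, ← Multiset.singleton_add]
    ac_rfl

theorem clsIco_eq (x q a : ℕ) :
    clsIco x q a (a + x) = (Multiset.range (x * q)).map (a + ·) := by
  induction q with
  | zero => simp [clsIco, cls]
  | succ q ih =>
    have : clsIco x (q + 1) a (a + x)
        = clsIco x q a (a + x) + ∑ k ∈ Finset.Ico a (a + x), {x * q + k} := by
      simp only [clsIco, ← Finset.sum_add_distrib, cls_succ]
    rw [this, ih, mul_add, mul_one, range_add_eq, Multiset.map_add]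
    congr 1
    rw [Finset.sum_Ico_eq_sum_range, ← Multiset.coe_mapAddMonoidHom, map_sum]
    simp only [Multiset.coe_mapAddMonoidHom, Multiset.map_singleton, Nat.add_sub_cancel_left]
    exact Finset.sum_congr rfl fun k _ => by congr 1; ring

theorem clsIco_union {x q a r : ℕ} (hr : r ≤ x) :
    clsIco x (q + 1) a (a + r) + clsIco x q (a + r) (a + x)
      = (Multiset.range (x * q + r)).map (a + ·) := by
  have : clsIco x (q + 1) a (a + r)
      = clsIco x q a (a + r) + ∑ k ∈ Finset.Ico a (a + r), {x * q + k} := by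
    simp only [clsIco, ← Finset.sum_add_distrib, cls_succ]
  rw [this, add_right_comm, clsIco_add (by omega) (by omega), clsIco_eq, range_add_eq,
    Multiset.map_add]
  congr 1
  rw [Finset.sum_Ico_eq_sum_range, ← Multiset.coe_mapAddMonoidHom, map_sum]
  simp only [Multiset.coe_mapAddMonoidHom, Multiset.map_singleton, Nat.add_sub_cancel_left]
  exact Finset.sum_congr rfl fun k _ => by congr 1; ring

theorem clsIco_union_zero {x q r : ℕ} (hr : r ≤ x) :
    clsIco x (q + 1) 0 r + clsIco x q r x = Multiset.range (x * q + r) := by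
  simpa using clsIco_union (q := q) (a := 0) hr

theorem clsIco_union_one {x q r : ℕ} (hr : r ≤ x) :
    {0} + (clsIco x (q + 1) 1 (r + 1) + clsIco x q (r + 1) (x + 1))
      = Multiset.range (x * q + r + 1) := by
  have := clsIco_union (q := q) (a := 1) hr
  rw [add_comm 1 r, add_comm 1 x] at this
  rw [this, StepPath.range_succ_eq]
  simp only [add_comm]

theorem clsIco_one_succ {x q : ℕ} :
    {0} + clsIco x q 1 (x + 1) = Multiset.range (x * q + 1) := by
  simpa [clsIco_self] using clsIco_union_one (x := x) (q := q) (r := 0) (by omega)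

theorem clsIco_two_succ {x q : ℕ} :
    {0} + ({1} + clsIco x q 2 (x + 2)) = Multiset.range (x * q + 2) := by
  rw [add_comm x 2, clsIco_eq, StepPath.range_succ_eq, StepPath.range_succ_eq]
  simp only [Multiset.map_add, Multiset.map_singleton, zero_add, Multiset.map_map,
    Function.comp_def, add_assoc, Nat.reduceAdd, add_comm 2]

theorem mset3_add (a b c a' b' c' x y : ℕ) :
    mset3 a b c x y + mset3 a' b' c' x y = mset3 (a + a') (b + b') (c + c') x y := by
  simp only [mset3, Multiset.replicate_add]
  ac_rfl

theorem StepPath.toClassPath {t s e j : ℕ} {S : Multiset ℕ} (h : StepPath t s e S j) (x k : ℕ) :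
    ClassPath x t (x * s + k) (x * e + k) (S.map fun i => x * i + k) 0 j := by
  obtain ⟨i, h⟩ := h
  refine ⟨i, ?_⟩
  convert h.map x k using 1
  simp [mset3, mul_comm]

theorem StepPath.toClassPath_zero {t e j n : ℕ} (h : StepPath t 0 e (Multiset.range n) j)
    (x k : ℕ) : ClassPath x t k (x * e + k) (cls x k n) 0 j := by
  simpa [cls] using h.toClassPath x k

namespace ClassPath

variable {x t s e s' e' a a' c c' : ℕ} {S S' : Multiset ℕ}

theorem single (x t s : ℕ) : ClassPath x t s s {s} 0 0 := ⟨0, IsPath.single s⟩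

theorem reverse (h : ClassPath x t s e S a c) : ClassPath x t e s S a c :=
  h.imp fun _ h => h.reverse

theorem append (h : ClassPath x t s e S a c) (h' : ClassPath x t s' e' S' a' c')
    (hd : e + 1 = s' ∨ s' + 1 = e) : ClassPath x t s e' (S + S') (a + a' + 1) (c + c') := by
  obtain ⟨i, h⟩ := h
  obtain ⟨i', h'⟩ := h'
  refine ⟨i + i', ?_⟩
  convert h.append h' hd using 1
  rw [mset3_add, ← show mset3 1 0 0 x (t * x) = {1} by simp [mset3], mset3_add]
  rfl

theorem append_long (h : ClassPath x t s e S a c) (h' : ClassPath x t s' e' S' a' c')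
    (hd : e + x = s' ∨ s' + x = e) : ClassPath x t s e' (S + S') (a + a') (c + c') := by
  obtain ⟨i, h⟩ := h
  obtain ⟨i', h'⟩ := h'
  refine ⟨i + i' + 1, ?_⟩
  convert h.append h' hd using 1
  rw [mset3_add, ← show mset3 0 1 0 x (t * x) = {x} by simp [mset3], mset3_add]
  rfl

theorem toStepPath (h : ClassPath x t s e S a 0) :
    StepPath x s e S (Multiset.card S - 1 - a) := by
  obtain ⟨b, h⟩ := h
  refine ⟨a, ?_⟩
  have hc := h.card
  simp only [mset3, Multiset.card_add, Multiset.card_replicate] at hc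
  rw [show Multiset.card S - 1 - a = b by omega]
  simpa [mset3] using h

theorem hasStandard {b : ℕ} (h : ClassPath x t 0 e (Multiset.range (a + b + c + 1)) a c) :
    HasStandardLinearRealization (mset3 a b c x (t * x)) := by
  obtain ⟨b', h⟩ := h
  have hc := h.card
  simp only [mset3, Multiset.card_add, Multiset.card_replicate, Multiset.card_range] at hc
  obtain rfl : b' = b := by omega
  obtain ⟨l, h₁, h₂, -, h₄⟩ := h
  refine ⟨l, ⟨?_, h₄⟩, h₂⟩
  rw [← Multiset.coe_eq_coe, h₁]
  simp [mset3, Multiset.range]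

theorem pairUp {j n k u : ℕ} (hp : StepPath t 0 u (Multiset.range n) j)
    (h : ClassPath x t (k + 2) e S a c) :
    ClassPath x t k e (cls x k n + cls x (k + 1) n + S) (a + 2) (c + 2 * j) := by
  have := ((hp.toClassPath_zero x k).append (hp.toClassPath_zero x (k + 1)).reverse
    (by omega)).append h (by omega)
  convert this using 1 <;> omega

theorem pairDown {j n k u : ℕ} (hp : StepPath t 0 u (Multiset.range n) j)
    (h : ClassPath x t k e S a c) :
    ClassPath x t (k + 2) e (cls x (k + 2) n + cls x (k + 1) n + S) (a + 2) (c + 2 * j) := by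
  have := ((hp.toClassPath_zero x (k + 2)).append (hp.toClassPath_zero x (k + 1)).reverse
    (by omega)).append h (by omega)
  convert this using 1 <;> omega

theorem chainUp {n K : ℕ} (hK : ∀ j ≤ K, ∃ u, StepPath t 0 u (Multiset.range n) j)
    (m : ℕ) {k J : ℕ} (hJ : J ≤ m * K) (h : ClassPath x t (k + 2 * m) e S a c) :
    ClassPath x t k e (clsIco x n k (k + 2 * m) + S) (a + 2 * m) (c + 2 * J) := by
  induction m generalizing k J with
  | zero =>
    obtain rfl : J = 0 := by omega
    simpa [clsIco_self] using h
  | succ m ih =>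
    obtain ⟨u, hu⟩ := hK (min J K) (min_le_right _ _)
    have h₁ := ih (k := k + 2) (J := J - min J K)
      (by have : (m + 1) * K = m * K + K := by ring
          omega) (by rwa [add_assoc, add_comm 2, ← Nat.mul_succ])
    have h₂ := pairUp hu h₁
    rw [clsIco_cons (by omega), clsIco_cons (by omega)]
    convert h₂ using 1
    · rw [show k + 2 * (m + 1) = k + 2 + 2 * m by ring]
      simp only [add_assoc]
    · ring
    · omega

theorem chainDown {n K : ℕ} (hK : ∀ j ≤ K, ∃ u, StepPath t 0 u (Multiset.range n) j)
    (m : ℕ) {k J : ℕ} (hJ : J ≤ m * K) (h : ClassPath x t k e S a c) :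
    ClassPath x t (k + 2 * m) e (clsIco x n (k + 1) (k + 2 * m + 1) + S) (a + 2 * m)
      (c + 2 * J) := by
  induction m generalizing J with
  | zero =>
    obtain rfl : J = 0 := by omega
    simpa [clsIco_self] using h
  | succ m ih =>
    obtain ⟨u, hu⟩ := hK (min J K) (min_le_right _ _)
    have h₁ := ih (J := J - min J K)
      (by have : (m + 1) * K = m * K + K := by ring
          omega)
    have h₂ := pairDown hu h₁
    rw [show k + 2 * (m + 1) + 1 = k + 2 * m + 2 + 1 by ring, clsIco_succ (by omega),
      show k + 2 * m + 2 = k + 2 * m + 1 + 1 by ring, clsIco_succ (by omega)]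
    convert h₂ using 1
    · omega
    · rw [show k + 2 * m + 1 + 1 = k + 2 * m + 2 from rfl]
      abel
    · omega
    · omega

theorem stairDown (m : ℕ) {k : ℕ} (h : ClassPath x t k e S a c) :
    ClassPath x t (k + m) e (clsIco x 1 (k + 1) (k + m + 1) + S) (a + m) c := by
  induction m with
  | zero => simpa [clsIco_self] using h
  | succ m ih =>
    have := (single x t (k + (m + 1))).append ih (by omega)
    rw [← cls_one x] at this
    rw [show k + (m + 1) + 1 = k + m + 1 + 1 by ring, clsIco_succ (by omega)]
    convert this using 1
    · rw [show k + m + 1 = k + (m + 1) by ring]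
      ac_rfl
    · omega
    · omega

end ClassPath

theorem StepPath.exists_of_le_zero (t : ℕ) {n : ℕ} (hn : 1 ≤ n) :
    ∀ j ≤ 0, ∃ u, StepPath t 0 u (Multiset.range n) j := by
  intro j hj
  obtain rfl : j = 0 := by omega
  exact ⟨n - 1, by simpa [Nat.sub_add_cancel hn] using straight t (n - 1)⟩

theorem ClassPath.ascend {x t q h g f S K₁ K₂ J₁ J₂ a c} (hg : g ≤ h)
    (hK₁ : ∀ j ≤ K₁, ∃ u, StepPath t 0 u (Multiset.range (q + 1)) j)
    (hK₂ : ∀ j ≤ K₂, ∃ u, StepPath t 0 u (Multiset.range q) j)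
    (hJ₁ : J₁ ≤ g * K₁) (hJ₂ : J₂ ≤ (h - g) * K₂)
    (hS : ClassPath x t (2 * h) f S a c) :
    ClassPath x t 0 f (clsIco x (q + 1) 0 (2 * g) + (clsIco x q (2 * g) (2 * h) + S))
      (a + 2 * h) (c + 2 * J₁ + 2 * J₂) := by
  have hh : 2 * g + 2 * (h - g) = 2 * h := by omega
  have h₂ := chainUp hK₂ (h - g) (k := 2 * g) hJ₂ (by rwa [hh])
  have h₁ := chainUp hK₁ g (k := 0) hJ₁ (by rwa [zero_add])
  rw [hh, zero_add] at h₁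
  convert h₁ using 1 <;> omega

theorem ClassPath.descend {x t n k m f S K J a c} (hk : k + 2 * m = x)
    (hK : ∀ j ≤ K, ∃ u, StepPath t 0 u (Multiset.range n) j) (hJ : J ≤ m * K)
    (hS : ClassPath x t k f S a c) :
    ClassPath x t 0 f ({0} + (clsIco x n (k + 1) (x + 1) + S)) (a + 2 * m) (c + 2 * J) := by
  have h₁ := chainDown hK m hJ hS
  rw [hk] at h₁
  have := (single x t 0).append_long h₁ (by omega)
  convert this using 1 <;> omega

/-- Three paths which together cover three neighbouring classes of size `n`, with `j` differences
`t` in total. -/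
def TriplePath (t n j : ℕ) : Prop :=
  ∃ z e w S₁ S₂ j₁ j₂ j₃ j₄, StepPath t 0 e (Multiset.range n) j₁ ∧
    StepPath t 0 z (Multiset.range n) j₂ ∧ StepPath t 0 w S₁ j₃ ∧ StepPath t z e S₂ j₄ ∧
    S₁ + S₂ = Multiset.range n ∧ j₁ + j₂ + j₃ + j₄ = j

namespace TriplePath

variable {t n j : ℕ}

theorem succ (h : TriplePath t n j) : TriplePath t (n + 1) j := by
  obtain ⟨z, e, w, S₁, S₂, j₁, j₂, j₃, j₄, h₁, h₂, h₃, h₄, hS, rfl⟩ := h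
  refine ⟨z + 1, e + 1, w + 1, _, _, j₁, j₂, j₃, j₄, h₁.cons_range, h₂.cons_range, h₃.cons,
    h₄.shift, ?_, rfl⟩
  rw [StepPath.range_succ_eq, ← hS, Multiset.map_add, add_assoc]

theorem of_stepPath {w : ℕ} (h : StepPath t 0 w (Multiset.range n) j) :
    TriplePath t (n + 1) j :=
  ⟨n, n, w, _, {n}, 0, 0, j, 0, .straight t n, .straight t n, h, .single t n,
    by rw [Multiset.range_succ, ← Multiset.singleton_add, add_comm], by omega⟩

theorem classPath (h : TriplePath t n j) (x : ℕ) :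
    ∃ f, ClassPath x t 3 f (clsIco x n 1 4) 3 j := by
  obtain ⟨z, e, w, S₁, S₂, j₁, j₂, j₃, j₄, h₁, h₂, h₃, h₄, hS, rfl⟩ := h
  refine ⟨x * w + 2, ?_⟩
  have hc : cls x 2 n = S₁.map (fun i => x * i + 2) + S₂.map fun i => x * i + 2 := by
    rw [cls, ← hS, Multiset.map_add]
  have := (((h₁.toClassPath_zero x 3).append (h₄.toClassPath x 2).reverse (by omega)).append
    (h₂.toClassPath_zero x 1).reverse (by omega)).append (h₃.toClassPath x 2) (by omega)
  convert this using 1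
  · rw [clsIco_succ (by omega), clsIco_succ (by omega), clsIco_succ (by omega), clsIco_self, hc,
      zero_add]
    ac_rfl
  · omega

theorem descend {x q h g K₁ K₂ J₁ J₂ τ} (hT : TriplePath t (q + 1) τ) (hx : x = 2 * h + 1)
    (hg₂ : 2 ≤ g) (hg : g ≤ h)
    (hK₁ : ∀ j ≤ K₁, ∃ u, StepPath t 0 u (Multiset.range (q + 1)) j)
    (hK₂ : ∀ j ≤ K₂, ∃ u, StepPath t 0 u (Multiset.range q) j)
    (hJ₁ : J₁ ≤ (g - 2) * K₁) (hJ₂ : J₂ ≤ (h - g + 1) * K₂) :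
    ∃ f, ClassPath x t 0 f (Multiset.range (x * q + 2 * g)) x (τ + 2 * J₁ + 2 * J₂) := by
  obtain ⟨f, hf⟩ := hT.classPath x
  have h₁ := ClassPath.chainDown hK₁ (g - 2) hJ₁ hf
  have h₂ := ClassPath.descend (by omega) hK₂ hJ₂ h₁
  refine ⟨f, ?_⟩
  convert h₂ using 1
  · have := clsIco_union_one (x := x) (q := q) (r := 2 * g - 1) (by omega)
    rw [show x * q + (2 * g - 1) + 1 = x * q + 2 * g by omega] at this
    rw [← this, show 3 + 2 * (g - 2) + 1 = 2 * g - 1 + 1 by omega,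
      ← clsIco_add (x := x) (n := q + 1) (k₁ := 1) (k₂ := 4) (by omega) (by omega)]
    abel
  · omega

end TriplePath

/-! ### Covering an interval with differences `1`, `t` -/

theorem cls_succ_left (x k n : ℕ) :
    cls x k (n + 1) = {k} + ((Multiset.range n).map (· + 1)).map fun i => x * i + k := by
  rw [cls, StepPath.range_succ_eq, Multiset.map_add, Multiset.map_singleton, mul_zero, zero_add]

theorem ClassPath.up {t e S a k n} (hn : 1 ≤ n) (m : ℕ) (h : ClassPath t 0 (k + 2 * m) e S a 0) :
    ClassPath t 0 k e (clsIco t n k (k + 2 * m) + S) (a + 2 * m) 0 :=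
  chainUp (StepPath.exists_of_le_zero 0 hn) m (J := 0) (by omega) h

theorem ClassPath.down {t e S a k n} (hn : 1 ≤ n) (m : ℕ) (h : ClassPath t 0 k e S a 0) :
    ClassPath t 0 (k + 2 * m) e (clsIco t n (k + 1) (k + 2 * m + 1) + S) (a + 2 * m) 0 :=
  chainDown (StepPath.exists_of_le_zero 0 hn) m (J := 0) (by omega) h

theorem ClassPath.line (t k : ℕ) {n : ℕ} (hn : 1 ≤ n) :
    ClassPath t 0 k (t * (n - 1) + k) (cls t k n) 0 0 := by
  obtain ⟨n, rfl⟩ := Nat.exists_eq_add_of_le' hn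
  exact (StepPath.straight 0 n).toClassPath_zero t k

/-- There is a path through `{0, …, n - 1}` from `0` with `n - t` differences `t`, the last
of them among these, the others being `1`. -/
def LongEnd (t n : ℕ) : Prop :=
  ∃ w z S, StepPath t 0 w S (n - t - 1) ∧ S + {z} = Multiset.range n ∧ (w + t = z ∨ z + t = w)

namespace LongEnd

variable {t n : ℕ}

theorem of_classPath {w z S} (ht : 1 ≤ t) (h : ClassPath t 0 0 w S (t - 1) 0)
    (hS : S + {z} = Multiset.range n) (hd : w + t = z ∨ z + t = w) : LongEnd t n := by
  refine ⟨w, z, S, ?_, hS, hd⟩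
  have := congrArg Multiset.card hS
  simp only [Multiset.card_add, Multiset.card_singleton, Multiset.card_range] at this
  convert h.toStepPath using 1
  omega

theorem of_odd {u h g : ℕ} (hu : 2 ≤ u) (hg : g ≤ h) :
    LongEnd (2 * h + 1) ((2 * h + 1) * u + 2 * g) := by
  have h₁ := ClassPath.ascend (q := u) hg (StepPath.exists_of_le_zero 0 (by omega))
    (StepPath.exists_of_le_zero 0 (by omega)) (J₁ := 0) (J₂ := 0) (by omega) (by omega)
    (ClassPath.line (2 * h + 1) (2 * h) (n := u - 1) (by omega))
  obtain ⟨u, rfl⟩ := Nat.exists_eq_add_of_le' hu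
  refine of_classPath (z := (2 * h + 1) * (u + 1) + 2 * h) (by omega)
    (by convert h₁ using 1; omega) ?_ (.inl (by simp; ring))
  rw [← clsIco_union_zero (by omega), clsIco_succ (k₁ := 2 * g) (k₂ := 2 * h) (by omega)]
  simp only [show u + 2 - 1 = u + 1 from rfl, cls_succ _ _ (u + 1)]
  abel

theorem of_odd_one {u h : ℕ} (hu : 2 ≤ u) :
    LongEnd (2 * h + 1) ((2 * h + 1) * u + 1) := by
  have h₁ := ClassPath.descend (n := u) (m := h) (by omega)
    (StepPath.exists_of_le_zero 0 (by omega)) (J := 0) (by omega)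
    (ClassPath.line (2 * h + 1) 1 (n := u - 1) (by omega))
  obtain ⟨u, rfl⟩ := Nat.exists_eq_add_of_le' hu
  refine of_classPath (z := (2 * h + 1) * (u + 1) + 1) (by omega)
    (by convert h₁ using 1; omega) ?_ (.inl (by simp; ring))
  rw [← clsIco_one_succ, clsIco_cons (k₁ := 1) (by omega)]
  simp only [show u + 2 - 1 = u + 1 from rfl, cls_succ _ _ (u + 1)]
  abel

theorem tail (t : ℕ) {n k k' : ℕ} (hn : 2 ≤ n) (hk : k' = k + 1 ∨ k = k' + 1) :
    ∃ S, ClassPath t 0 k (t + k') S 1 0 ∧ S + {k'} = cls t k n + cls t k' n := by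
  obtain ⟨n, rfl⟩ := Nat.exists_eq_add_of_le' hn
  have h₁ := ClassPath.line t k (n := n + 2) (by omega)
  have h₂ := ((StepPath.straight 0 n).shift.toClassPath t k').reverse
  rw [zero_add, mul_one] at h₂
  refine ⟨_, h₁.append h₂ (by rw [show n + 2 - 1 = n + 1 from rfl]; omega), ?_⟩
  rw [cls_succ_left t k' (n + 1)]
  abel

theorem of_even {u t ρ : ℕ} (hu : 2 ≤ u) (ht : Even t) (hρ : Even ρ) (h : ρ < t) :
    LongEnd t (t * u + ρ) := by
  obtain ⟨k, rfl⟩ := ht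
  obtain ⟨g, rfl⟩ := hρ
  obtain ⟨S, hS, hS'⟩ := tail (k + k) hu (k := 0 + 2 * g + 2 * (k - 1 - g)) (k' := k + k - 1)
    (by omega)
  have h₁ := (hS.up (n := u) (by omega)).up (k := 0) (n := u + 1) (m := g) (by omega)
  refine of_classPath (z := k + k - 1) (by omega) (by convert h₁ using 1; omega) ?_
    (.inr (by omega))
  rw [← clsIco_union_zero (by omega), add_assoc, add_assoc, hS',
    ← clsIco_add (x := k + k) (n := u) (k₁ := g + g) (k₂ := k + k - 2) (by omega) (by omega),
    clsIco_cons (k₁ := k + k - 2) (by omega), clsIco_cons (k₁ := k + k - 2 + 1) (by omega),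
    show k + k - 2 + 1 + 1 = k + k by omega, clsIco_self,
    show 0 + 2 * g + 2 * (k - 1 - g) = k + k - 2 by omega, show k + k - 2 + 1 = k + k - 1 by omega,
    show 0 + 2 * g = g + g by omega, ← two_mul g, add_zero]

theorem of_even_odd {u t g : ℕ} (hu : 1 ≤ u) (ht : Even t) (h : 2 * g + 3 < t) :
    LongEnd t (t * u + 2 * g + 3) := by
  obtain ⟨k, rfl⟩ := ht
  obtain ⟨S, hS, hS'⟩ := tail (k + k) (n := u + 1) (by omega) (k := 2) (k' := 1) (by omega)
  have h₁ := ClassPath.descend (n := u) (m := k - g - 1) (by omega)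
    (StepPath.exists_of_le_zero 0 (by omega)) (J := 0) (by omega)
    (hS.down (n := u + 1) (m := g) (by omega))
  refine of_classPath (z := 1) (by omega) (by convert h₁ using 1; omega) ?_
    (.inr (by omega))
  have := clsIco_union_one (x := k + k) (q := u) (r := 2 * g + 2) (by omega)
  rw [show (k + k) * u + 2 * g + 3 = (k + k) * u + (2 * g + 2) + 1 by ring, ← this,
    clsIco_cons (k₁ := 1) (by omega), clsIco_cons (k₁ := 1 + 1) (by omega), add_comm 2 (2 * g),
    add_assoc, add_assoc, add_assoc _ S, hS']
  abel

theorem of_even_one {u t : ℕ} (hu : 2 ≤ u) (ht : Even t) (h : 1 < t) :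
    LongEnd t (t * u + 1) := by
  obtain ⟨k, rfl⟩ := ht
  obtain ⟨S, hS, hS'⟩ := tail (k + k) hu (k := 2) (k' := 1) (by omega)
  have h₁ := ClassPath.descend (n := u) (m := k - 1) (by omega)
    (StepPath.exists_of_le_zero 0 (by omega)) (J := 0) (by omega) hS
  refine of_classPath (z := 1) (by omega) (by convert h₁ using 1; omega) ?_
    (.inr (by omega))
  rw [add_assoc, add_assoc, hS', ← clsIco_one_succ, clsIco_cons (k₁ := 1) (by omega),
    clsIco_cons (k₁ := 1 + 1) (by omega)]
  abel

theorem of_lt {t g : ℕ} (h : 2 * g + 2 < t) : LongEnd t (t + (2 * g + 2)) := by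
  have h₁ := ((ClassPath.single t 0 1).down (n := 2) (m := g) (by omega)).stairDown (t - 2 * g - 1)
  have h₂ := (ClassPath.single t 0 0).append_long h₁ (by omega)
  refine of_classPath (z := t + 1) (by omega) (by convert h₂ using 1; omega) ?_ (.inl (by omega))
  have := clsIco_union_one (x := t) (q := 1) (r := 2 * g + 1) (by omega)
  rw [mul_one] at this
  rw [show t + (2 * g + 2) = t + (2 * g + 1) + 1 by rfl, ← this, clsIco_cons (k₁ := 1) (by omega),
    cls_succ, cls_one, show 1 + 2 * g + (t - 2 * g - 1) + 1 = t + 1 by omega,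
    show 1 + 2 * g = 2 * g + 1 by omega, mul_one]
  abel

theorem of_good (ht : 2 ≤ t) (hn : t + 2 ≤ n) (hg : Even t ∨ Even (n % t) ∨ n % t = 1) :
    LongEnd t n := by
  have hlt := Nat.mod_lt n (show 0 < t by omega)
  have hdm := Nat.div_add_mod n t
  have h₁ : 1 ≤ n / t := Nat.div_pos (by omega) (by omega)
  generalize n / t = u at *
  generalize n % t = ρ at *
  subst hdm
  rcases h₁.eq_or_lt with rfl | hu
  · rw [mul_one] at hn ⊢
    rcases Nat.even_or_odd' ρ with ⟨g, rfl | rfl⟩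
    · obtain ⟨g, rfl⟩ := Nat.exists_eq_add_of_le' (show 1 ≤ g by omega)
      exact of_lt hlt
    · obtain ⟨g, rfl⟩ := Nat.exists_eq_add_of_le' (show 1 ≤ g by omega)
      have ht' : Even t := by
        rcases hg with h | h | h
        · exact h
        · exact absurd h (by simp)
        · omega
      convert of_even_odd le_rfl ht' (g := g) (by omega) using 1
      ring
  · rcases Nat.even_or_odd t with he | ⟨h, rfl⟩
    · rcases Nat.even_or_odd' ρ with ⟨g, rfl | rfl⟩
      · exact of_even hu he (by simp) hlt
      · rcases g with - | g
        · exact of_even_one hu he (by omega)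
        · convert of_even_odd h₁ he (g := g) (by omega) using 1
          ring
    · rcases hg with hg | hg | rfl
      · exact absurd hg (by simp)
      · obtain ⟨g, rfl⟩ := hg
        rw [← two_mul g]
        exact of_odd hu (by omega)
      · exact of_odd_one hu

theorem triplePath (h : LongEnd t n) (hn : t + 1 ≤ n) : TriplePath t n (3 * (n - t) - 1) := by
  obtain ⟨w, z, S, h, hS, hd⟩ := h
  have h₁ := h.append_long (.single t z) hd
  rw [hS] at h₁
  exact ⟨z, z, w, S, {z}, _, _, _, _, h₁, h₁, h, .single t z, hS, by omega⟩

end LongEnd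

namespace StepPath

theorem exists_max {t n : ℕ} (ht : 2 ≤ t) (hn : t + 1 ≤ n)
    (hg : Even t ∨ Even (n % t) ∨ n % t = 1) :
    ∃ e, StepPath t 0 e (Multiset.range n) (n - t) := by
  rcases hn.eq_or_lt with rfl | hn
  · have h₁ := (ClassPath.single t 0 1).stairDown (t - 1)
    have h₂ := ((ClassPath.single t 0 0).append_long h₁ (by omega)).toStepPath
    have : {0} + (clsIco t 1 (1 + 1) (1 + (t - 1) + 1) + {1}) = Multiset.range (t + 1) := by
      have := clsIco_one_succ (x := t) (q := 1)
      rw [mul_one, clsIco_cons (by omega), cls_one] at this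
      rw [← this, show 1 + (t - 1) + 1 = t + 1 by omega]
      abel
    rw [this, Multiset.card_range] at h₂
    exact ⟨1, by convert h₂ using 1; omega⟩
  · obtain ⟨w, z, S, h, hS, hd⟩ := LongEnd.of_good ht hn hg
    have h₁ := h.append_long (.single t z) hd
    rw [hS] at h₁
    exact ⟨z, by convert h₁ using 1; omega⟩

theorem exists_of_lt {t n j : ℕ} (ht : 2 ≤ t) (hn : j + t + 1 ≤ n) :
    ∃ e, StepPath t 0 e (Multiset.range n) j := by
  rcases Nat.eq_zero_or_pos j with rfl | hj
  · exact exists_of_le_zero t (by omega) 0 le_rfl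
  by_cases hg : Even t ∨ Even ((j + t) % t) ∨ (j + t) % t = 1
  · obtain ⟨e, h⟩ := exists_max ht (by omega) hg
    rw [Nat.add_sub_cancel] at h
    exact ⟨_, h.cons_range_of_le (by omega)⟩
  · push Not at hg
    obtain ⟨ht', hj', hj₁⟩ := hg
    rw [Nat.not_even_iff_odd] at ht' hj'
    obtain ⟨h, rfl⟩ := ht'
    obtain ⟨g, hg⟩ := hj'
    have hlt := Nat.mod_lt (j + (2 * h + 1)) (show 0 < 2 * h + 1 by omega)
    have hdm := Nat.div_add_mod (j + (2 * h + 1)) (2 * h + 1)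
    have h₁ : 1 ≤ (j + (2 * h + 1)) / (2 * h + 1) := Nat.div_pos (by omega) (by omega)
    rw [hg] at hdm hlt
    generalize (j + (2 * h + 1)) / (2 * h + 1) = u at *
    obtain ⟨f, hf⟩ := (TriplePath.of_stepPath (straight 0 (u - 1))).descend (x := 2 * h + 1)
      (q := u - 1 + 1) (g := g + 1) rfl (by omega) (by omega) (exists_of_le_zero 0 (by omega))
      (exists_of_le_zero 0 (by omega)) (J₁ := 0) (J₂ := 0) (by omega) (by omega)
    rw [Nat.sub_add_cancel h₁] at hf
    have h₂ := hf.toStepPath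
    have h₃ : (2 * h + 1) * u + 2 * (g + 1) = j + (2 * h + 1) + 1 := by omega
    rw [Multiset.card_range, h₃] at h₂
    have h₄ : ∃ e, StepPath (2 * h + 1) 0 e (Multiset.range (j + (2 * h + 1) + 1)) j :=
      ⟨f, by convert h₂ using 1; omega⟩
    obtain ⟨e, he⟩ := h₄
    exact ⟨_, he.cons_range_of_le hn⟩

end StepPath

theorem StepPath.exists_ascend {u h g : ℕ} (hu : 1 ≤ u) (hg : g ≤ h) :
    ∃ e, e + 1 = (2 * h + 1) * u ∧ StepPath (2 * h + 1) 0 e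
      (Multiset.range ((2 * h + 1) * u + 2 * g)) ((2 * h + 1) * u + 2 * g - (2 * h + 1)) := by
  have h₁ := (ClassPath.ascend (q := u) hg (exists_of_le_zero 0 (by omega))
    (exists_of_le_zero 0 (by omega)) (J₁ := 0) (J₂ := 0) (by omega) (by omega)
    (ClassPath.line (2 * h + 1) (2 * h) hu)).toStepPath
  rw [← clsIco_succ (by omega), clsIco_union_zero (by omega), Multiset.card_range] at h₁
  obtain ⟨u, rfl⟩ := Nat.exists_eq_add_of_le' hu
  exact ⟨_, (by rw [Nat.add_sub_cancel]; ring :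
    (2 * h + 1) * (u + 1 - 1) + 2 * h + 1 = _), by convert h₁ using 1; omega⟩

/-- Two disjoint paths covering `{0, …, n - 1}` with `n - t` differences `t`, joined by a
difference `1`, where the second one starts at the end of a path with `n - t` differences `t`. -/
theorem TriplePath.of_odd {u h g : ℕ} (hu : 1 ≤ u) (hg₁ : 1 ≤ g) (hg : g ≤ h) :
    TriplePath (2 * h + 1) ((2 * h + 1) * u + 2 * g)
      (3 * ((2 * h + 1) * u + 2 * g - (2 * h + 1))) := by
  have hQ := (ClassPath.descend (K := 0) (J := 0) (n := u) (k := 1 + 2 * (g - 1)) (m := h - g + 1)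
    (by omega) (StepPath.exists_of_le_zero 0 hu) (by omega)
    ((ClassPath.line (2 * h + 1) 1 (n := u + 1) (by omega)).down (n := u + 1)
      (m := g - 1) (by omega))).toStepPath
  have hS : {0} + (clsIco (2 * h + 1) u (1 + 2 * (g - 1) + 1) (2 * h + 1 + 1) +
      (clsIco (2 * h + 1) (u + 1) (1 + 1) (1 + 2 * (g - 1) + 1) + cls (2 * h + 1) 1 (u + 1)))
      = Multiset.range ((2 * h + 1) * u + 2 * g) := by
    have := clsIco_union_one (x := 2 * h + 1) (q := u) (r := 2 * g - 1) (by omega)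
    rw [show (2 * h + 1) * u + 2 * g = (2 * h + 1) * u + (2 * g - 1) + 1 by omega, ← this,
      clsIco_cons (k₁ := 1) (by omega), show 1 + 2 * (g - 1) + 1 = 2 * g - 1 + 1 by omega]
    abel
  rw [hS, Multiset.card_range] at hQ
  have hP₁ := (ClassPath.line (2 * h + 1) 0 (n := u + 1) (by omega)).toStepPath
  have hP₂ := ((ClassPath.line (2 * h + 1) 1 (n := u + 1) (by omega)).reverse.append
    (((ClassPath.line (2 * h + 1) (2 + 2 * (g - 1) + 2 * (h - g)) hu).up (n := u) hu (h - g)).up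
      (n := u + 1) (by omega) (g - 1)) (by omega)).toStepPath
  have hS' : cls (2 * h + 1) 0 (u + 1) + (cls (2 * h + 1) 1 (u + 1) +
      (clsIco (2 * h + 1) (u + 1) 2 (2 + 2 * (g - 1)) +
      (clsIco (2 * h + 1) u (2 + 2 * (g - 1)) (2 + 2 * (g - 1) + 2 * (h - g)) +
      cls (2 * h + 1) (2 + 2 * (g - 1) + 2 * (h - g)) u)))
      = Multiset.range ((2 * h + 1) * u + 2 * g) := by
    have := clsIco_union_zero (x := 2 * h + 1) (q := u) (r := 2 * g) (by omega)
    rw [← clsIco_succ (by omega), ← this, clsIco_cons (k₁ := 0) (by omega),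
      clsIco_cons (k₁ := 0 + 1) (by omega), show 2 + 2 * (g - 1) = 2 * g by omega,
      show 2 * g + 2 * (h - g) + 1 = 2 * h + 1 by omega]
    abel
  have hc := congrArg Multiset.card hS'
  rw [Multiset.card_add, Multiset.card_range] at hc
  have hc₁ : Multiset.card (cls (2 * h + 1) 0 (u + 1)) = u + 1 := by simp [cls]
  have h₃ := hP₁.append hP₂ (by simp)
  rw [hS'] at h₃
  refine ⟨_, _, _, _, _, _, _, _, _, h₃, hQ, hP₁, hP₂, hS', ?_⟩
  have h₄ : (2 * h + 1) * u = 2 * h * u + u := by ring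
  have h₅ : 2 * h ≤ 2 * h * u := Nat.le_mul_of_pos_right _ hu
  rw [hc₁] at hc ⊢
  rw [Nat.eq_sub_of_add_eq' hc]
  omega

/-- A path covering an initial segment of `ℕ` which splits at a difference `t`, together with a
path on a segment shorter by one. -/
theorem StepPath.exists_split {u h g : ℕ} (hu : 1 ≤ u) (hg : g + 2 ≤ h) :
    ∃ z w e S₁ S₂ j₁ j₂, z + (2 * h + 1) = w + 1 ∧ StepPath (2 * h + 1) 0 (w + 1) S₁ j₁ ∧
      StepPath (2 * h + 1) z e S₂ j₂ ∧
      S₁ + S₂ = Multiset.range ((2 * h + 1) * u + 2 * g + 4) ∧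
      j₁ + j₂ + 1 = (2 * h + 1) * u + 2 * g + 4 - (2 * h + 1) ∧
      StepPath (2 * h + 1) 0 w (Multiset.range ((2 * h + 1) * u + 2 * g + 3))
        ((2 * h + 1) * u + 2 * g - (2 * h + 1)) := by
  obtain ⟨e, he, hQ⟩ := exists_ascend hu (g := g) (h := h) (by omega)
  obtain ⟨u, rfl⟩ := Nat.exists_eq_add_of_le' hu
  have hP₁ := ((((ClassPath.line (2 * h + 1) 0 (n := u + 2) (by omega)).append
    (ClassPath.line (2 * h + 1) 1 (n := u + 2) (by omega)).reverse (by omega)).append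
    (ClassPath.line (2 * h + 1) 2 (n := u + 2) (by omega)) (by omega)).append
    (ClassPath.single _ _ ((2 * h + 1) * (u + 1) + 3)) (by simp)).toStepPath
  have hP₂ := ((ClassPath.line (2 * h + 1) 3 (n := u + 1) (by omega)).reverse.append
    (((ClassPath.line (2 * h + 1) (4 + 2 * g + 2 * (h - g - 2)) hu).up (n := u + 1) hu
      (h - g - 2)).up (n := u + 2) (by omega) g) (by omega)).toStepPath
  have hS : cls (2 * h + 1) 0 (u + 2) + cls (2 * h + 1) 1 (u + 2) + cls (2 * h + 1) 2 (u + 2) +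
      {(2 * h + 1) * (u + 1) + 3} + (cls (2 * h + 1) 3 (u + 1) +
      (clsIco (2 * h + 1) (u + 2) 4 (4 + 2 * g) +
      (clsIco (2 * h + 1) (u + 1) (4 + 2 * g) (4 + 2 * g + 2 * (h - g - 2)) +
      cls (2 * h + 1) (4 + 2 * g + 2 * (h - g - 2)) (u + 1))))
      = Multiset.range ((2 * h + 1) * (u + 1) + 2 * g + 4) := by
    have := clsIco_union_zero (x := 2 * h + 1) (q := u + 1) (r := 4 + 2 * g) (by omega)
    have h₃ : cls (2 * h + 1) 3 (u + 2) = cls (2 * h + 1) 3 (u + 1) +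
      {(2 * h + 1) * (u + 1) + 3} := cls_succ _ _ _
    rw [← clsIco_succ (by omega), show (2 * h + 1) * (u + 1) + 2 * g + 4 =
        (2 * h + 1) * (u + 1) + (4 + 2 * g) by ring, ← this,
      clsIco_cons (k₁ := 0) (by omega), clsIco_cons (k₁ := 0 + 1) (by omega),
      clsIco_cons (k₁ := 0 + 1 + 1) (by omega), clsIco_cons (k₁ := 0 + 1 + 1 + 1) (by omega),
      show 4 + 2 * g + 2 * (h - g - 2) + 1 = 2 * h + 1 by omega]
    simp only [zero_add, Nat.reduceAdd, show u + 1 + 1 = u + 2 from rfl, h₃]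
    ac_rfl
  have hw : (2 * h + 1) * (u + 1) + 3 = e + 3 + 1 := by omega
  rw [hw] at hP₁ hS
  have hc := congrArg Multiset.card hS
  have hc₁ : ∀ k n, Multiset.card (cls (2 * h + 1) k n) = n := fun k n => by simp [cls]
  rw [Multiset.card_add, Multiset.card_range] at hc
  refine ⟨_, e + 3, _, _, _, _, _, ?_, hP₁, hP₂, hS, ?_, hQ.cons_range.cons_range.cons_range⟩
  · rw [Nat.add_sub_cancel]
    rw [mul_add] at he
    omega
  · rw [Nat.eq_sub_of_add_eq' hc]
    simp only [Multiset.card_add, hc₁, Multiset.card_singleton]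
    have h₄ : (2 * h + 1) * (u + 1) = 2 * (h * u) + 2 * h + u + 1 := by ring
    have h₅ : u ≤ h * u := Nat.le_mul_of_pos_left _ (by omega)
    omega

/-! ### Residues of the number of differences which are multiples of `x` -/

namespace ClassPath

variable {x t e n a c : ℕ}

theorem cons_range (h : ClassPath x t 0 e (Multiset.range n) a c) :
    ClassPath x t 0 (e + 1) (Multiset.range (n + 1)) (a + 1) c := by
  obtain ⟨b, h⟩ := h
  have h₁ : ClassPath x t (0 + 1) (e + 1) ((Multiset.range n).map (· + 1)) a c :=
    ⟨b, by simpa using h.map 1 1⟩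
  have h₂ := (single x t 0).append h₁ (by omega)
  rw [StepPath.range_succ_eq]
  convert h₂ using 1 <;> omega

theorem cons_range_add (h : ∃ e, ClassPath x t 0 e (Multiset.range n) a c) (m : ℕ) :
    ∃ e, ClassPath x t 0 e (Multiset.range (n + m)) (a + m) c := by
  induction m with
  | zero => exact h
  | succ m ih =>
    obtain ⟨e, he⟩ := ih
    exact ⟨_, he.cons_range⟩

theorem hasStandard_of_le {a₀ b : ℕ}
    (h : ∃ e, ClassPath x t 0 e (Multiset.range (b + c + a₀ + 1)) a₀ c) (ha : a₀ ≤ a) :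
    HasStandardLinearRealization (mset3 a b c x (t * x)) := by
  obtain ⟨e, he⟩ := cons_range_add h (a - a₀)
  rw [Nat.add_sub_cancel' ha, show b + c + a₀ + 1 + (a - a₀) = a + b + c + 1 by omega] at he
  exact he.hasStandard

end ClassPath

theorem StepPath.exists_of_le_one {t M j : ℕ} (ht : 2 ≤ t) (hj : j ≤ 1 ∨ j ≤ M) :
    ∃ e, StepPath t 0 e (Multiset.range (M + t + 1)) j := by
  by_cases hM : j ≤ M
  · exact exists_of_lt ht (by omega)
  · obtain rfl : M = 0 := by omega
    obtain rfl : j = 1 := by omega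
    convert exists_max (n := 0 + t + 1) ht (by omega)
      (.inr (.inr (by rw [zero_add, Nat.add_mod_left, Nat.mod_eq_of_lt (by omega)]))) using 4
    omega

theorem exists_mod_eq_of_not_good {t n : ℕ} (hn : t ≤ n) (ht : 0 < t)
    (h : ¬(Even t ∨ Even (n % t) ∨ n % t = 1)) :
    ∃ k u g, 1 ≤ u ∧ g + 2 ≤ k ∧ t = 2 * k + 1 ∧ n = (2 * k + 1) * u + 2 * g + 3 := by
  simp only [not_or, Nat.not_even_iff_odd] at h
  obtain ⟨⟨k, rfl⟩, ⟨g, hg⟩, h₁⟩ := h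
  have h₂ := Nat.div_add_mod n (2 * k + 1)
  have h₃ := Nat.mod_lt n ht
  exact ⟨k, n / (2 * k + 1), g - 1, Nat.div_pos hn ht, by omega, rfl, by omega⟩

theorem exists_classPath_even {t h g M c : ℕ} (ht : 2 ≤ t) (hg : g ≤ h)
    (hc : c ≤ (2 * h + 1) * M + 2 * g) :
    ∃ e, ClassPath (2 * h + 1) t 0 e (Multiset.range ((2 * h + 1) * (M + t + 1) + 2 * g))
      (2 * h) c := by
  obtain ⟨j, hj, R, hR, rfl⟩ : ∃ j, (j ≤ 1 ∨ j ≤ M) ∧ ∃ R, R ≤ h * M + g ∧ c = j + 2 * R := by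
    have : (2 * h + 1) * M = 2 * (h * M) + M := by ring
    by_cases hc' : c ≤ 2 * (h * M) + 2 * g
    · exact ⟨c % 2, by omega, c / 2, by omega, by omega⟩
    · exact ⟨c - 2 * (h * M + g), by omega, h * M + g, by omega, by omega⟩
  obtain ⟨d, rfl⟩ := Nat.exists_eq_add_of_le hg
  obtain ⟨J₁, J₂, hJ₁, hJ₂, rfl⟩ : ∃ J₁ J₂, J₁ ≤ g * (M + 1) ∧ J₂ ≤ d * M ∧ R = J₁ + J₂ := by
    have : (g + d) * M + g = g * (M + 1) + d * M := by ring
    exact ⟨min R (g * (M + 1)), R - min R (g * (M + 1)), by omega, by omega, by omega⟩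
  obtain ⟨e, he⟩ := StepPath.exists_of_le_one ht hj
  have := ClassPath.ascend (q := M + t + 1) hg (K₁ := M + 1) (K₂ := M) (J₁ := J₁) (J₂ := J₂)
    (fun j hj => StepPath.exists_of_lt ht (by omega))
    (fun j hj => StepPath.exists_of_lt ht (by omega)) hJ₁ (by simpa using hJ₂)
    (he.toClassPath_zero (2 * (g + d) + 1) (2 * (g + d)))
  rw [← clsIco_succ (by omega), clsIco_union_zero (by omega)] at this
  exact ⟨_, by convert this using 1 <;> omega⟩

theorem exists_classPath_one {t h M c : ℕ} (ht : 2 ≤ t) (hc : c ≤ (2 * h + 1) * M) :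
    ∃ e, ClassPath (2 * h + 1) t 0 e (Multiset.range ((2 * h + 1) * (M + t + 1) + 1))
      (2 * h) c := by
  obtain ⟨j, hj, R, hR, rfl⟩ : ∃ j, (j ≤ 1 ∨ j ≤ M) ∧ ∃ R, R ≤ h * M ∧ c = j + 2 * R := by
    have : (2 * h + 1) * M = 2 * (h * M) + M := by ring
    by_cases hc' : c ≤ 2 * (h * M)
    · exact ⟨c % 2, by omega, c / 2, by omega, by omega⟩
    · exact ⟨c - 2 * (h * M), by omega, h * M, by omega, by omega⟩
  obtain ⟨e, he⟩ := StepPath.exists_of_le_one ht hj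
  have := ClassPath.descend (n := M + t + 1) (m := h) (K := M) (by omega)
    (fun j hj => StepPath.exists_of_lt ht (by omega)) hR (he.toClassPath_zero (2 * h + 1) 1)
  refine ⟨(2 * h + 1) * e + 1, ?_⟩
  rw [← clsIco_one_succ, clsIco_cons (by omega), add_comm (cls _ _ _)]
  convert this using 1
  omega

theorem exists_classPath_two {t h M c j R : ℕ} (ht : 2 ≤ t) (hR : R ≤ h * M) (hc : c = j + 2 * R)
    (hj : ∃ e, StepPath t 0 e (Multiset.range (M + t + 1)) j) :
    ∃ e, ClassPath (2 * h + 1) t 0 e (Multiset.range ((2 * h + 1) * (M + t + 1) + 2))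
      (2 * h + 1) c := by
  obtain ⟨e, he⟩ := hj
  have := (ClassPath.single (2 * h + 1) t 0).append
    ((ClassPath.single (2 * h + 1) t 1).append_long
      (ClassPath.chainDown (n := M + t + 1) (K := M)
        (fun j hj => StepPath.exists_of_lt ht (by omega)) h hR
        (he.toClassPath_zero (2 * h + 1) 2)) (by omega)) (by omega)
  have hS : {0} + ({1} + (clsIco (2 * h + 1) (M + t + 1) (2 + 1) (2 + 2 * h + 1) +
      cls (2 * h + 1) 2 (M + t + 1))) = Multiset.range ((2 * h + 1) * (M + t + 1) + 2) := by
    rw [← clsIco_two_succ, clsIco_cons (k₁ := 2) (by omega), add_comm (cls _ _ _),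
      show 2 + 2 * h + 1 = 2 * h + 1 + 2 by ring]
  rw [hS] at this
  exact ⟨_, by convert this using 1 <;> omega⟩

theorem exists_classPath_two_of_not_good {k h u g : ℕ} (hh : 1 ≤ h) (hu : 1 ≤ u)
    (hg : g + 2 ≤ k) :
    ∃ e, ClassPath (2 * h + 1) (2 * k + 1) 0 e
      (Multiset.range ((2 * h + 1) * ((2 * k + 1) * u + 2 * g + 3) + 2)) (2 * h + 1)
      ((2 * h + 1) * ((2 * k + 1) * u + 2 * g + 3 - (2 * k + 1) - 1) + 1) := by
  obtain ⟨z, w, e, S₁, S₂, j₁, j₂, hz, hP₁, hP₂, hS, hj, hQ⟩ := StepPath.exists_split hu hg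
  have hP := hP₁.append_long hP₂ (by omega)
  rw [hS] at hP
  have hle : 2 * k + 1 ≤ (2 * k + 1) * u := Nat.le_mul_of_pos_right _ hu
  obtain ⟨M, hM⟩ := Nat.exists_eq_add_of_le
    (show 2 * k + 1 + 1 ≤ (2 * k + 1) * u + 2 * g + 3 by omega)
  have hM' : (2 * k + 1) * u + 2 * g + 4 = M + (2 * k + 1) + 1 + 1 := by omega
  rw [hM'] at hP hS
  rw [show (2 * k + 1) * u + 2 * g + 3 = M + (2 * k + 1) + 1 by omega] at hQ ⊢
  have := (hP₁.toClassPath (2 * h + 1) 0).append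
    ((hQ.toClassPath_zero (2 * h + 1) (2 * h)).reverse.append
      (ClassPath.chainDown (n := M + (2 * k + 1) + 1) (K := M) (J := (h - 1) * M) (k := 1)
        (fun j hj => StepPath.exists_of_lt (by omega) (by omega)) (h - 1) le_rfl
        ((hP.toClassPath_zero (2 * h + 1) 1).append (hP₂.toClassPath (2 * h + 1) 0).reverse
          (by omega))) (by omega)) (by right; ring)
  refine ⟨(2 * h + 1) * z + 0, ?_⟩
  convert this using 1
  · simp
  · rw [← clsIco_union_zero (r := 2) (by omega), clsIco_succ (k₁ := 0) (k₂ := 1) (by omega),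
      clsIco_one, clsIco_succ (k₁ := 2) (by omega), cls, ← hS, Multiset.map_add,
      show 1 + 2 * (h - 1) + 1 = 2 * h by omega]
    ac_rfl
  · omega
  · obtain ⟨h, rfl⟩ := Nat.exists_eq_add_of_le' hh
    have h₁ : (2 * (h + 1) + 1) * M = 2 * (h * M) + 3 * M := by ring
    rw [show M + (2 * k + 1) + 1 - (2 * k + 1) - 1 = M by omega, h₁, Nat.add_sub_cancel]
    omega

theorem exists_classPath_two_of_le {t h M c : ℕ} (ht : 2 ≤ t) (hh : 1 ≤ h)
    (hc : c ≤ (2 * h + 1) * M + 1) :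
    ∃ e, ClassPath (2 * h + 1) t 0 e (Multiset.range ((2 * h + 1) * (M + t + 1) + 2))
      (2 * h + 1) c := by
  have hM : (2 * h + 1) * M = 2 * (h * M) + M := by ring
  by_cases hc₁ : c ≤ 2 * (h * M)
  · exact exists_classPath_two ht (j := c % 2) (R := c / 2) (by omega) (by omega)
      (StepPath.exists_of_le_one ht (by omega))
  by_cases hc₂ : c ≤ 2 * (h * M) + M
  · exact exists_classPath_two ht (j := c - 2 * (h * M)) le_rfl (by omega)
      (StepPath.exists_of_le_one ht (by omega))
  obtain rfl : c = (2 * h + 1) * M + 1 := by omega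
  by_cases hg : Even t ∨ Even ((M + t + 1) % t) ∨ (M + t + 1) % t = 1
  · refine exists_classPath_two ht (j := M + 1) le_rfl (by omega) ?_
    have := StepPath.exists_max ht (by omega) hg
    rwa [show M + t + 1 - t = M + 1 by omega] at this
  · obtain ⟨k, u, g, hu, hgk, rfl, hq⟩ := exists_mod_eq_of_not_good (by omega) (by omega) hg
    have := exists_classPath_two_of_not_good hh hu hgk
    rw [← hq] at this
    rwa [show M + (2 * k + 1) + 1 - (2 * k + 1) - 1 = M by omega] at this

theorem TriplePath.exists_of_good {t M : ℕ} (ht : 2 ≤ t) (hM : 1 ≤ M)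
    (hg : Even t ∨ Even ((M + t + 1) % t) ∨ (M + t + 1) % t = 1) (c : ℕ) :
    ∃ τ, TriplePath t (M + t + 1 + 1) τ ∧ τ % 2 = c % 2 ∧ 3 * M + 2 ≤ τ ∧ τ ≤ 3 * M + 5 := by
  by_cases hc : c % 2 = (3 * M + 2) % 2
  · have := (LongEnd.of_good ht (by omega) hg).triplePath (by omega)
    exact ⟨_, this.succ, by omega, by omega, by omega⟩
  by_cases hg' : Even t ∨ Even ((M + t + 1 + 1) % t) ∨ (M + t + 1 + 1) % t = 1
  · have := (LongEnd.of_good ht (by omega) hg').triplePath (by omega)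
    exact ⟨_, this, by omega, by omega, by omega⟩
  · obtain ⟨k, u, g, hu, hgk, rfl, hq⟩ := exists_mod_eq_of_not_good (by omega) (by omega) hg'
    have := TriplePath.of_odd (u := u) (h := k) (g := g + 1) hu (by omega) (by omega)
    rw [show (2 * k + 1) * u + 2 * (g + 1) = M + (2 * k + 1) + 1 by omega] at this
    exact ⟨_, this.succ, by omega, by omega, by omega⟩

theorem exists_classPath_odd {t h g M c : ℕ} (ht : 2 ≤ t) (hg₂ : 2 ≤ g) (hg : g ≤ h)
    (hc : c ≤ (2 * h + 1) * M + 2 * g - 1) :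
    ∃ e, ClassPath (2 * h + 1) t 0 e (Multiset.range ((2 * h + 1) * (M + t + 1) + 2 * g))
      (2 * h + 1) c := by
  obtain ⟨d, rfl⟩ := Nat.exists_eq_add_of_le hg
  obtain ⟨g, rfl⟩ := Nat.exists_eq_add_of_le' hg₂
  have key : ∀ K, (∀ j ≤ K, ∃ u, StepPath t 0 u (Multiset.range (M + t + 1)) j) →
      ∀ τ, TriplePath t (M + t + 1 + 1) τ → τ % 2 = c % 2 → τ ≤ c →
      c ≤ τ + 2 * (g * (M + 1) + (d + 1) * K) →
      ∃ e, ClassPath (2 * (g + 2 + d) + 1) t 0 e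
        (Multiset.range ((2 * (g + 2 + d) + 1) * (M + t + 1) + 2 * (g + 2)))
        (2 * (g + 2 + d) + 1) c := by
    intro K hK τ hτ h₁ h₂ h₃
    obtain ⟨J₁, J₂, hJ₁, hJ₂, rfl⟩ : ∃ J₁ J₂, J₁ ≤ g * (M + 1) ∧ J₂ ≤ (d + 1) * K ∧
        c = τ + 2 * J₁ + 2 * J₂ :=
      ⟨min ((c - τ) / 2) (g * (M + 1)), (c - τ) / 2 - min ((c - τ) / 2) (g * (M + 1)),
        by omega, by omega, by omega⟩
    exact hτ.descend rfl hg₂ hg (K₁ := M + 1) (fun j hj => StepPath.exists_of_lt ht (by omega))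
      hK (by simpa using hJ₁) (by simpa using hJ₂)
  have low : ∀ j, j ≤ 1 ∨ j ≤ M → TriplePath t (M + t + 1 + 1) j := fun j hj => by
    obtain ⟨e, he⟩ := StepPath.exists_of_le_one ht hj
    exact .of_stepPath he
  by_cases hq : Even t ∨ Even ((M + t + 1) % t) ∨ (M + t + 1) % t = 1
  · have hmax : ∃ e, StepPath t 0 e (Multiset.range (M + t + 1)) (M + 1) := by
      have := StepPath.exists_max ht (by omega) hq
      rwa [show M + t + 1 - t = M + 1 by omega] at this
    have hK : ∀ j ≤ M + 1, ∃ u, StepPath t 0 u (Multiset.range (M + t + 1)) j := fun j hj => by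
      rcases hj.eq_or_lt with rfl | hj
      · exact hmax
      · exact StepPath.exists_of_lt ht (by omega)
    have hW : g * (M + 1) + (d + 1) * (M + 1) = g * M + d * M + g + d + M + 1 := by ring
    have hc' : (2 * (g + 2 + d) + 1) * M = 2 * (g * M) + 2 * (d * M) + 5 * M := by ring
    by_cases hc₁ : c ≤ 2 * (g * (M + 1) + (d + 1) * (M + 1))
    · exact key _ hK (c % 2) (low _ (by omega)) (by omega) (by omega) (by omega)
    by_cases hc₂ : c ≤ 2 * (g * (M + 1) + (d + 1) * (M + 1)) + (M + 1)
    · obtain ⟨e, he⟩ := hK (c - 2 * (g * (M + 1) + (d + 1) * (M + 1))) (by omega)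
      exact key _ hK _ (.of_stepPath he) (by omega) (by omega) (by omega)
    obtain ⟨τ, hτ, h₁, h₂, h₃⟩ := TriplePath.exists_of_good ht (by omega) hq c
    exact key _ hK τ hτ h₁ (by omega) (by omega)
  · have hK : ∀ j ≤ M, ∃ u, StepPath t 0 u (Multiset.range (M + t + 1)) j := fun j hj =>
      StepPath.exists_of_lt ht (by omega)
    have hW : g * (M + 1) + (d + 1) * M = g * M + d * M + g + M := by ring
    have hc' : (2 * (g + 2 + d) + 1) * M = 2 * (g * M) + 2 * (d * M) + 5 * M := by ring
    obtain ⟨k, u, p, hu, hp, rfl, hM⟩ := exists_mod_eq_of_not_good (by omega) (by omega) hq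
    by_cases hc₁ : c ≤ 2 * (g * (M + 1) + (d + 1) * M)
    · exact key _ hK (c % 2) (low _ (by omega)) (by omega) (by omega) (by omega)
    by_cases hc₂ : c ≤ 2 * (g * (M + 1) + (d + 1) * M) + M
    · exact key _ hK _ (low (c - 2 * (g * (M + 1) + (d + 1) * M)) (by omega)) (by omega) (by omega)
        (by omega)
    have hn : (2 * k + 1) * u + 2 * (p + 1) = M + (2 * k + 1) := by omega
    have hn' : (2 * k + 1) * u + 2 * (p + 2) = M + (2 * k + 1) + 1 + 1 := by omega
    have hle : 2 * k + 1 ≤ (2 * k + 1) * u := Nat.le_mul_of_pos_right _ hu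
    have hT : ∀ i, 1 ≤ i → i ≤ k →
        TriplePath (2 * k + 1) ((2 * k + 1) * u + 2 * i)
          (3 * ((2 * k + 1) * u + 2 * i - (2 * k + 1)) - 1) ∧
        TriplePath (2 * k + 1) ((2 * k + 1) * u + 2 * i)
          (3 * ((2 * k + 1) * u + 2 * i - (2 * k + 1))) := fun i hi₁ hi => by
      refine ⟨(LongEnd.of_good (by omega) (by omega) (.inr (.inl ?_))).triplePath (by omega),
        .of_odd hu hi₁ hi⟩
      rw [Nat.mul_add_mod, Nat.mod_eq_of_lt (by omega)]
      exact even_two_mul i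
    obtain ⟨h₁, h₂⟩ := hT (p + 1) (by omega) (by omega)
    obtain ⟨h₃, h₄⟩ := hT (p + 2) (by omega) (by omega)
    rw [hn] at h₁ h₂
    rw [hn'] at h₃ h₄
    by_cases hp₀ : c % 2 = M % 2
    · by_cases hc₃ : c ≤ 2 * (g * (M + 1) + (d + 1) * M) + 3 * M
      · exact key _ hK _ h₂.succ.succ (by omega) (by omega) (by omega)
      · exact key _ hK _ h₄ (by omega) (by omega) (by omega)
    · by_cases hc₃ : c ≤ 2 * (g * (M + 1) + (d + 1) * M) + 3 * M
      · exact key _ hK _ h₁.succ.succ (by omega) (by omega) (by omega)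
      · exact key _ hK _ h₃ (by omega) (by omega) (by omega)

/-- Let `x ≥ 3` be odd, `t ≥ 2`, `v = a + b + c + 1 ≥ (t+2)x`,
`v = qx + r` with `0 ≤ r < x`, `s = ⌊q/(2t)⌋` and `a ≥ ω(x, b + c)`. Then
`{1^a, x^b, (tx)^c}` has a standard linear realization if (1) `r` is even and
`b ≥ tx`; or (2) `r, t` are odd and `b ≥ tx + 2t - 3`; or (3) `r` is odd, `t`
is even and `b ≥ 4s + tx + 4t - 9`. -/
theorem stmt14 (x t a b c : ℕ) (hx : 3 ≤ x) (hxo : Odd x) (ht : 2 ≤ t)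
    (hv : (t + 2) * x ≤ a + b + c + 1)
    (ha : omegaBHR x (b + c) ≤ a)
    (hcase :
      (Even ((a + b + c + 1) % x) ∧ t * x ≤ b) ∨
      (Odd ((a + b + c + 1) % x) ∧ Odd t ∧ t * x + 2 * t - 3 ≤ b) ∨
      (Odd ((a + b + c + 1) % x) ∧ Even t ∧
        4 * ((a + b + c + 1) / x / (2 * t)) + t * x + 4 * t - 9 ≤ b)) :
    HasStandardLinearRealization (mset3 a b c x (t * x)) := by
  have hb_odd : Odd ((a + b + c + 1) % x) → t * x + 1 ≤ b := by
    intro hodd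
    rcases hcase with ⟨he, -⟩ | ⟨-, ⟨k, rfl⟩, h⟩ | ⟨-, ⟨k, rfl⟩, h⟩
    · exact absurd he (Nat.not_even_iff_odd.2 hodd)
    · omega
    · obtain rfl | hk : k = 1 ∨ 2 ≤ k := by omega
      · have := (Nat.le_div_iff_mul_le (show 0 < x by omega)).2 hv
        omega
      · omega
  have hb : t * x ≤ b := by
    rcases hcase with ⟨-, h⟩ | ⟨h, -⟩ | ⟨h, -⟩
    · exact h
    · exact (Nat.le_succ _).trans (hb_odd h)
    · exact (Nat.le_succ _).trans (hb_odd h)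
  obtain ⟨h, rfl⟩ := hxo
  have hdm := Nat.div_add_mod (b + c) (2 * h + 1)
  have hlt := Nat.mod_lt (b + c) (show 0 < 2 * h + 1 by omega)
  obtain ⟨M, hM⟩ := Nat.exists_eq_add_of_le
    ((Nat.le_div_iff_mul_le (show 0 < 2 * h + 1 by omega)).2
      (show t * (2 * h + 1) ≤ b + c by omega))
  rw [omegaBHR, hM] at ha
  rw [hM] at hdm
  have hv' : (2 * h + 1) * (M + t + 1) = (2 * h + 1) * (t + M) + 2 * h + 1 := by ring
  have hv'' : (2 * h + 1) * (t + M) = t * (2 * h + 1) + (2 * h + 1) * M := by ring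
  generalize (b + c) % (2 * h + 1) = r at *
  rcases Nat.even_or_odd' r with ⟨g, rfl | rfl⟩
  · refine ClassPath.hasStandard_of_le (a₀ := 2 * h) ?_ (by split_ifs at ha <;> omega)
    convert exists_classPath_even (h := h) (g := g) (M := M) (c := c) ht (by omega) (by omega)
      using 4
    omega
  rcases g.eq_zero_or_pos with rfl | hg
  · by_cases ha' : 2 * h + 1 ≤ a
    · refine ClassPath.hasStandard_of_le (a₀ := 2 * h + 1) ?_ ha'
      convert exists_classPath_two_of_le (h := h) (M := M) (c := c) ht (by omega) (by omega)
        using 4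
      omega
    · obtain rfl : a = 2 * h := by split_ifs at ha <;> omega
      refine ClassPath.hasStandard_of_le (a₀ := 2 * h) ?_ le_rfl
      convert exists_classPath_one (h := h) (M := M) (c := c) ht ?_ using 4
      · omega
      · have hmod : (2 * h + b + c + 1) % (2 * h + 1) = 1 := by
          rw [show 2 * h + b + c + 1 = 1 + (2 * h + 1) * (M + t + 1) by omega,
            Nat.add_mul_mod_self_left, Nat.mod_eq_of_lt (by omega)]
        have := hb_odd (by rw [hmod]; exact odd_one)
        omega
  · have : 2 * h + 1 ≤ a := by
      rw [if_neg] at ha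
      · exact ha
      · simp
        omega
    refine ClassPath.hasStandard_of_le (a₀ := 2 * h + 1) ?_ this
    convert exists_classPath_odd (h := h) (g := g + 1) (M := M) (c := c) ht (by omega) (by omega)
      (by omega) using 4
    omega
end

section
/- Let L = {1^a, 3^b, y^c} be an admissible multiset of size v − 1 with y > 3. Write v = 3q + r with 0 ≤ r < 3. Then L has a linear realization in each of the following cases: (1) a ≥ y + 1; (2) a ≥ 7 and b ≥ y − 4; (3) a ≥ 4, a + b ≥ y + 1 and c ≡ 0 or 1 (mod y); (4) a ≥ 2, y = 3t for some integer t, v ≥ 3t + 6, and either r is even and b ≥ 3t, or r is odd and b ≥ 3t + 1. -/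
/-- `Trail y S x e α β`: there is a path through the vertices `S` (with multiplicity) from `x` to
`e` all of whose steps have length `1`, `3` or `y`, where `α` steps of length `1`, `β` steps of
length `3` and an unrecorded number of steps of length `y` are used. -/
inductive Trail (y : ℕ) : Multiset ℕ → ℕ → ℕ → ℕ → ℕ → Prop
  | single (x : ℕ) : Trail y {x} x x 0 0
  | one {S x e α β} (z : ℕ) (h : Trail y S x e α β) (hz : z + 1 = x ∨ x + 1 = z) :
      Trail y (z ::ₘ S) z e (α + 1) β
  | three {S x e α β} (z : ℕ) (h : Trail y S x e α β) (hz : z + 3 = x ∨ x + 3 = z) :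
      Trail y (z ::ₘ S) z e α (β + 1)
  | long {S x e α β} (z : ℕ) (h : Trail y S x e α β) (hz : z + y = x ∨ x + y = z) :
      Trail y (z ::ₘ S) z e α β

/-- A step between `p` and `q` of length `1`, `3` or `y` that is recorded by `i` and `j`. -/
def IsStep (y p q i j : ℕ) : Prop :=
  ((p + 1 = q ∨ q + 1 = p) ∧ i = 1 ∧ j = 0) ∨ ((p + 3 = q ∨ q + 3 = p) ∧ i = 0 ∧ j = 1) ∨
    ((p + y = q ∨ q + y = p) ∧ i = 0 ∧ j = 0)

namespace Trail

variable {y : ℕ} {S T : Multiset ℕ} {x e x' e' α β α' β' i j : ℕ}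

theorem cons (z : ℕ) (h : Trail y S x e α β) (hz : IsStep y z x i j) :
    Trail y (z ::ₘ S) z e (α + i) (β + j) := by
  rcases hz with ⟨hz, rfl, rfl⟩ | ⟨hz, rfl, rfl⟩ | ⟨hz, rfl, rfl⟩
  · exact h.one z hz
  · exact h.three z hz
  · exact h.long z hz

theorem start_mem (h : Trail y S x e α β) : x ∈ S := by
  cases h <;> simp

theorem append (h : Trail y S x e α β) (h' : Trail y T x' e' α' β') (hs : IsStep y e x' i j) :
    Trail y (S + T) x e' (α + α' + i) (β + β' + j) := by
  induction h with
  | single z =>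
    have := h'.cons z hs
    simpa [Multiset.singleton_add] using this
  | one z _ hz ih =>
    have := (ih hs).one z hz
    rw [Multiset.cons_add]
    convert this using 1; omega
  | three z _ hz ih =>
    have := (ih hs).three z hz
    rw [Multiset.cons_add]
    convert this using 1; omega
  | long z _ hz ih =>
    rw [Multiset.cons_add]
    exact (ih hs).long z hz

/-- Two trails sharing the vertex at which the first ends and the second starts. -/
theorem join (h : Trail y S x e α β) (h' : Trail y (e ::ₘ T) e e' α' β') :
    Trail y (S + T) x e' (α + α') (β + β') := by
  induction h with
  | single z => simpa [Multiset.singleton_add] using h'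
  | one z _ hz ih =>
    have := (ih h').one z hz
    rw [Multiset.cons_add]
    convert this using 1; omega
  | three z _ hz ih =>
    have := (ih h').three z hz
    rw [Multiset.cons_add]
    convert this using 1; omega
  | long z _ hz ih =>
    rw [Multiset.cons_add]
    exact (ih h').long z hz

theorem snoc (h : Trail y S x e α β) (z : ℕ) (hz : IsStep y e z i j) :
    Trail y (z ::ₘ S) x z (α + i) (β + j) := by
  have := h.append (single z) hz
  rwa [Multiset.add_comm, Multiset.singleton_add] at this

theorem reverse (h : Trail y S x e α β) : Trail y S e x α β := by
  induction h with
  | single z => exact single z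
  | one z _ hz ih => exact ih.snoc z (Or.inl ⟨by omega, rfl, rfl⟩)
  | three z _ hz ih => exact ih.snoc z (Or.inr (Or.inl ⟨by omega, rfl, rfl⟩))
  | long z _ hz ih => exact ih.snoc z (Or.inr (Or.inr ⟨by omega, rfl, rfl⟩))

theorem shift (h : Trail y S x e α β) (k : ℕ) :
    Trail y (S.map (· + k)) (x + k) (e + k) α β := by
  induction h with
  | single z => simpa using single (y := y) (z + k)
  | one z _ hz ih => rw [Multiset.map_cons]; exact ih.one _ (by omega)
  | three z _ hz ih => rw [Multiset.map_cons]; exact ih.three _ (by omega)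
  | long z _ hz ih => rw [Multiset.map_cons]; exact ih.long _ (by omega)

theorem reflect (h : Trail y S x e α β) (N : ℕ) (hN : ∀ z ∈ S, z ≤ N) :
    Trail y (S.map (N - ·)) (N - x) (N - e) α β := by
  induction h with
  | single z => simpa using single (y := y) (N - z)
  | one z h hz ih =>
    have h1 := hN _ (Multiset.mem_cons_of_mem h.start_mem)
    have h2 := hN z (Multiset.mem_cons_self _ _)
    rw [Multiset.map_cons]
    exact (ih fun w hw => hN w (Multiset.mem_cons_of_mem hw)).one _ (by omega)
  | three z h hz ih =>
    have h1 := hN _ (Multiset.mem_cons_of_mem h.start_mem)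
    have h2 := hN z (Multiset.mem_cons_self _ _)
    rw [Multiset.map_cons]
    exact (ih fun w hw => hN w (Multiset.mem_cons_of_mem hw)).three _ (by omega)
  | long z h hz ih =>
    have h1 := hN _ (Multiset.mem_cons_of_mem h.start_mem)
    have h2 := hN z (Multiset.mem_cons_self _ _)
    rw [Multiset.map_cons]
    exact (ih fun w hw => hN w (Multiset.mem_cons_of_mem hw)).long _ (by omega)

/-- Dilation by `3` turns steps of length `1` and `y` into steps of length `3` and `3 * y`. -/
theorem dilate (h : Trail y S x e α 0) (i : ℕ) :
    Trail (3 * y) (S.map (3 * · + i)) (3 * x + i) (3 * e + i) 0 α := by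
  generalize hb : (0 : ℕ) = b at h
  induction h with
  | single z => simpa using single (y := 3 * y) (3 * z + i)
  | one z h hz ih =>
    subst hb
    rw [Multiset.map_cons]; exact (ih rfl).three _ (by omega)
  | three z h hz ih => omega
  | long z h hz ih =>
    subst hb
    rw [Multiset.map_cons]; exact (ih rfl).long _ (by omega)

theorem le_card (h : Trail y S x e α β) : α + β + 1 ≤ S.card := by
  induction h <;> simp <;> omega

theorem exists_list (h : Trail y S x e α β) :
    ∃ l : List ℕ, (↑(x :: l) : Multiset ℕ) = S ∧
      linDiffs (x :: l) = mset3 α β (S.card - 1 - α - β) 3 y := by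
  have key : ∀ (z w : ℕ) (l : List ℕ), linDiffs (z :: w :: l) =
      ((z - w) + (w - z)) ::ₘ linDiffs (w :: l) := by
    intro z w l; simp [linDiffs]
  induction h with
  | single x => exact ⟨[], by simp, by simp [linDiffs, mset3]⟩
  | @one S x e α β z h hz ih =>
    obtain ⟨l, hl, hd⟩ := ih
    refine ⟨x :: l, by rw [← hl]; rfl, ?_⟩
    have h1 : (z - x) + (x - z) = 1 := by omega
    have h2 : S.card + 1 - 1 - (α + 1) - β = S.card - 1 - α - β := by omega
    rw [key, hd, h1, Multiset.card_cons, h2]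
    simp [mset3, Multiset.replicate_succ]
  | @three S x e α β z h hz ih =>
    obtain ⟨l, hl, hd⟩ := ih
    refine ⟨x :: l, by rw [← hl]; rfl, ?_⟩
    have h1 : (z - x) + (x - z) = 3 := by omega
    have h2 : S.card + 1 - 1 - α - (β + 1) = S.card - 1 - α - β := by omega
    rw [key, hd, h1, Multiset.card_cons, h2]
    simp [mset3, Multiset.replicate_succ]
  | @long S x e α β z h hz ih =>
    obtain ⟨l, hl, hd⟩ := ih
    refine ⟨x :: l, by rw [← hl]; rfl, ?_⟩
    have h1 : (z - x) + (x - z) = y := by omega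
    have h2 : S.card + 1 - 1 - α - β = (S.card - 1 - α - β) + 1 := by
      have := h.le_card; omega
    rw [key, hd, h1, Multiset.card_cons, h2]
    simp [mset3, Multiset.replicate_succ]

end Trail

theorem hasLinearRealization_of_trail {a b c y x e : ℕ}
    (h : Trail y (Multiset.range (a + b + c + 1)) x e a b) :
    HasLinearRealization (mset3 a b c 3 y) := by
  obtain ⟨l, hl, hd⟩ := h.exists_list
  refine ⟨x :: l, ?_, ?_⟩
  · have hc : (mset3 a b c 3 y).card = a + b + c := by simp [mset3]
    rw [← Multiset.coe_eq_coe, hl, hc]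
    rfl
  · rw [hd, Multiset.card_range]
    congr 1; omega

section Blow

/-- The column of height `h` over `z`: the vertices `z, z + y, …, z + (h - 1) * y`. -/
def column (y h z : ℕ) : Multiset ℕ :=
  (Multiset.range h).map (fun k => z + k * y)

/-- The union of the columns of height `h` over the elements of `S`. -/
def blow (y h : ℕ) (S : Multiset ℕ) : Multiset ℕ :=
  S.bind (column y h)

variable {y : ℕ} {S T : Multiset ℕ} {x e α β i j : ℕ}

theorem blow_cons (y h z : ℕ) (S : Multiset ℕ) :
    blow y h (z ::ₘ S) = column y h z + blow y h S :=
  Multiset.cons_bind _ _ _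

theorem blow_add (y h : ℕ) (S T : Multiset ℕ) : blow y h (S + T) = blow y h S + blow y h T :=
  Multiset.add_bind _ _ _

theorem blow_singleton (y h z : ℕ) : blow y h {z} = column y h z :=
  Multiset.singleton_bind _ _

theorem blow_zero (y : ℕ) (S : Multiset ℕ) : blow y 0 S = 0 := by
  induction S using Multiset.induction with
  | empty => rfl
  | cons z S ih => rw [blow_cons, ih]; rfl

theorem column_succ (y h z : ℕ) : column y (h + 1) z = (z + h * y) ::ₘ column y h z := by
  simp [column, Multiset.range_succ]

theorem blow_succ (y h : ℕ) (S : Multiset ℕ) :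
    blow y (h + 1) S = blow y h S + S.map (· + h * y) := by
  induction S using Multiset.induction with
  | empty => rfl
  | cons z S ih =>
    rw [blow_cons, ih, blow_cons, column_succ, Multiset.map_cons]
    simp only [← Multiset.singleton_add]
    abel

theorem column_succ' (y h z : ℕ) : column y (h + 1) z = z ::ₘ column y h (z + y) := by
  induction h with
  | zero => simp [column]
  | succ h ih =>
    rw [column_succ, ih, column_succ, Multiset.cons_swap]
    congr 2; ring

theorem blow_one (y : ℕ) (S : Multiset ℕ) : blow y 1 S = S := by
  rw [blow_succ, blow_zero]; simp

theorem trail_column (y h z : ℕ) : Trail y (column y (h + 1) z) z (z + h * y) 0 0 := by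
  induction h with
  | zero => simpa [column] using Trail.single (y := y) z
  | succ h ih =>
    have := ih.snoc (i := 0) (j := 0) (z + (h + 1) * y)
      (Or.inr (Or.inr ⟨Or.inl (by ring), rfl, rfl⟩))
    rwa [← column_succ] at this

theorem IsStep.add_right {p q : ℕ} (h : IsStep y p q i j) (k : ℕ) :
    IsStep y (p + k) (q + k) i j := by
  unfold IsStep at *; omega

theorem IsStep.symm {p q : ℕ} (h : IsStep y p q i j) : IsStep y q p i j := by
  unfold IsStep at *; omega

/-- Running through columns of equal height alternately upwards and downwards. -/
theorem Trail.blow_parity (h : Trail y S x e α β) (k : ℕ) :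
    ((Odd S.card → Trail y (blow y (k + 1) S) x (e + k * y) α β) ∧
      (Even S.card → Trail y (blow y (k + 1) S) x e α β)) ∧
    ((Odd S.card → Trail y (blow y (k + 1) S) (x + k * y) e α β) ∧
      (Even S.card → Trail y (blow y (k + 1) S) (x + k * y) (e + k * y) α β)) := by
  have key : ∀ {S x e α β α' β'} (z : ℕ) (hs : ∃ i j, IsStep y z x i j ∧ α' = α + i ∧ β' = β + j),
      (((Odd S.card → Trail y (blow y (k + 1) S) x (e + k * y) α β) ∧
        (Even S.card → Trail y (blow y (k + 1) S) x e α β)) ∧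
      ((Odd S.card → Trail y (blow y (k + 1) S) (x + k * y) e α β) ∧
        (Even S.card → Trail y (blow y (k + 1) S) (x + k * y) (e + k * y) α β))) →
      (((Odd (z ::ₘ S).card → Trail y (blow y (k + 1) (z ::ₘ S)) z (e + k * y) α' β') ∧
        (Even (z ::ₘ S).card → Trail y (blow y (k + 1) (z ::ₘ S)) z e α' β')) ∧
      ((Odd (z ::ₘ S).card → Trail y (blow y (k + 1) (z ::ₘ S)) (z + k * y) e α' β') ∧
        (Even (z ::ₘ S).card →
          Trail y (blow y (k + 1) (z ::ₘ S)) (z + k * y) (e + k * y) α' β'))) := by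
    rintro S x e α β α' β' z ⟨i, j, hs, rfl, rfl⟩ ⟨⟨h1, h2⟩, h3, h4⟩
    have hup := trail_column y k z
    simp only [Multiset.card_cons, Nat.odd_add_one, Nat.even_add_one, Nat.not_odd_iff_even,
      Nat.not_even_iff_odd, blow_cons]
    refine ⟨⟨fun h => ?_, fun h => ?_⟩, fun h => ?_, fun h => ?_⟩
    · simpa using hup.append (h4 h) (hs.add_right _)
    · simpa using hup.append (h3 h) (hs.add_right _)
    · simpa using hup.reverse.append (h2 h) hs
    · simpa using hup.reverse.append (h1 h) hs
  induction h with
  | single z =>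
    have hup := trail_column y k z
    simp only [blow_singleton, Multiset.card_singleton]
    exact ⟨⟨fun _ => hup, fun h => absurd h (by decide)⟩, fun _ => hup.reverse,
      fun h => absurd h (by decide)⟩
  | one z h hz ih => exact key z ⟨1, 0, Or.inl ⟨by omega, rfl, rfl⟩, rfl, rfl⟩ ih
  | three z h hz ih => exact key z ⟨0, 1, Or.inr (Or.inl ⟨by omega, rfl, rfl⟩), rfl, rfl⟩ ih
  | long z h hz ih => exact key z ⟨0, 0, Or.inr (Or.inr ⟨by omega, rfl, rfl⟩), rfl, rfl⟩ ih

theorem Trail.exists_blow (h : Trail y S x e α β) (k : ℕ) :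
    (∃ e', Trail y (blow y (k + 1) S) x e' α β) ∧
      ∃ e', Trail y (blow y (k + 1) S) (x + k * y) e' α β := by
  obtain ⟨⟨h1, h2⟩, h3, h4⟩ := h.blow_parity k
  rcases Nat.even_or_odd S.card with hS | hS
  · exact ⟨⟨_, h2 hS⟩, _, h4 hS⟩
  · exact ⟨⟨_, h1 hS⟩, _, h3 hS⟩

/-- Running through columns of equal height, where the last column is visited in the middle of the
last but one. The last step of the trail is then used twice. -/
theorem Trail.blow_double {w : ℕ} (h : Trail y S x w α β) (hs : IsStep y w e i j) (k : ℕ) :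
    (∃ e', Trail y (blow y (k + 2) (e ::ₘ S)) x e' (α + 2 * i) (β + 2 * j)) ∧
      ∃ e', Trail y (blow y (k + 2) (e ::ₘ S)) (x + (k + 1) * y) e' (α + 2 * i) (β + 2 * j) := by
  have key : ∀ {S x α β} (z i' j' : ℕ), IsStep y z x i' j' →
      ((∃ e', Trail y (blow y (k + 2) (e ::ₘ S)) x e' (α + 2 * i) (β + 2 * j)) ∧
        ∃ e', Trail y (blow y (k + 2) (e ::ₘ S)) (x + (k + 1) * y) e' (α + 2 * i) (β + 2 * j)) →
      (∃ e', Trail y (blow y (k + 2) (e ::ₘ z ::ₘ S)) z e' (α + i' + 2 * i) (β + j' + 2 * j)) ∧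
        ∃ e', Trail y (blow y (k + 2) (e ::ₘ z ::ₘ S)) (z + (k + 1) * y) e'
          (α + i' + 2 * i) (β + j' + 2 * j) := by
    rintro S x α β z i' j' hz ⟨⟨e₁, h₁⟩, e₂, h₂⟩
    have hup := trail_column y (k + 1) z
    rw [Multiset.cons_swap, blow_cons y (k + 2) z]
    refine ⟨⟨e₂, ?_⟩, e₁, ?_⟩
    · convert hup.append h₂ (hz.add_right _) using 1 <;> omega
    · convert hup.reverse.append h₁ hz using 1 <;> omega
  induction h with
  | single w =>
    have hcol := trail_column y (k + 1) e
    rw [blow_cons, blow_singleton]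
    refine ⟨⟨w + y, ?_⟩, w + k * y, ?_⟩
    · have h₂ := (hcol.append (trail_column y k (w + y)).reverse
        (by convert hs.symm.add_right ((k + 1) * y) using 1; ring)).cons w hs
      rw [column_succ' y (k + 1) w, Multiset.add_cons]
      convert h₂ using 1 <;> omega
    · have h₂ := (hcol.reverse.append (trail_column y k w) hs.symm).cons
        (w + (k + 1) * y) (hs.add_right _)
      rw [column_succ y (k + 1) w, Multiset.add_cons]
      convert h₂ using 1 <;> omega
  | one z h hz ih => exact key z 1 0 (Or.inl ⟨by omega, rfl, rfl⟩) (ih hs)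
  | three z h hz ih => exact key z 0 1 (Or.inr (Or.inl ⟨by omega, rfl, rfl⟩)) (ih hs)
  | long z h hz ih => exact key z 0 0 (Or.inr (Or.inr ⟨by omega, rfl, rfl⟩)) (ih hs)

theorem Trail.exists_snoc (h : Trail y S x e α β) (hS : 2 ≤ S.card) (hc : α + β + 1 = S.card) :
    ∃ T w α' β' i j, Trail y T x w α' β' ∧ IsStep y w e i j ∧ e ::ₘ T = S ∧ i + j = 1 ∧
      α = α' + i ∧ β = β' + j := by
  cases h.reverse with
  | single => simp at hS
  | one z h' hz =>
    exact ⟨_, _, _, _, 1, 0, h'.reverse, Or.inl ⟨by omega, rfl, rfl⟩, rfl, rfl, rfl, rfl⟩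
  | three z h' hz =>
    exact ⟨_, _, _, _, 0, 1, h'.reverse, Or.inr (Or.inl ⟨by omega, rfl, rfl⟩), rfl, rfl, rfl, rfl⟩
  | long z h' hz =>
    have := h'.le_card
    rw [Multiset.card_cons] at hc
    omega

end Blow

section Intervals

variable {y : ℕ} {S T : Multiset ℕ} {x e α β i j : ℕ}

theorem Trail.cast {x' e' α' β' : ℕ} (h : Trail y S x e α β) (hS : S = T)
    (hx : x = x' ∧ e = e' ∧ α = α' ∧ β = β') : Trail y T x' e' α' β' := by
  obtain ⟨rfl, rfl, rfl, rfl⟩ := hx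
  subst hS
  exact h

theorem range_eq_Ico (m : ℕ) : Multiset.range m = Multiset.Ico 0 m := by
  simp [Multiset.Ico, Nat.Ico_zero_eq_range]

theorem map_sub_Ico {a b N : ℕ} (hb : b ≤ N + 1) :
    (Multiset.Ico a b).map (N - ·) = Multiset.Ico (N + 1 - b) (N + 1 - a) := by
  rw [(Multiset.Nodup.map_on ?_ Multiset.nodup_Ico).ext Multiset.nodup_Ico]
  · intro z
    simp only [Multiset.mem_map, Multiset.mem_Ico]
    exact ⟨by rintro ⟨w, hw, rfl⟩; omega, fun h => ⟨N - z, by omega, by omega⟩⟩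
  · intro z hz w hw h
    rw [Multiset.mem_Ico] at hz hw
    omega

/-- Translate a trail on `{0, …, m - 1}`. -/
theorem Trail.onIco {m : ℕ} (h : Trail y (Multiset.range m) x e α β) (p : ℕ) :
    Trail y (Multiset.Ico p (p + m)) (p + x) (p + e) α β := by
  refine (h.shift p).cast ?_ (by omega)
  rw [range_eq_Ico, Multiset.map_add_right_Ico, zero_add, add_comm]

/-- Reflect a trail on `{0, …, m - 1}`. -/
theorem Trail.mirrorIco {m : ℕ} (h : Trail y (Multiset.range m) x e α β) (p : ℕ) :
    Trail y (Multiset.Ico p (p + m)) (p + m - 1 - x) (p + m - 1 - e) α β := by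
  have hx := h.start_mem
  rw [Multiset.mem_range] at hx
  refine (h.reflect (p + m - 1) fun z hz => ?_).cast ?_ (by omega)
  · rw [Multiset.mem_range] at hz; omega
  · rw [range_eq_Ico, map_sub_Ico (by omega)]
    congr 1 <;> omega

theorem Trail.mirror {m : ℕ} (h : Trail y (Multiset.range m) x e α β) :
    Trail y (Multiset.range m) (m - 1 - x) (m - 1 - e) α β := by
  simpa [← range_eq_Ico] using h.mirrorIco 0

/-- The elements of a residue class modulo `3`. -/
def residues (i k : ℕ) : Multiset ℕ :=
  (Multiset.range k).map (3 * · + i)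

theorem count_range (z m : ℕ) : (Multiset.range m).count z = if z < m then 1 else 0 := by
  rw [Multiset.count_eq_of_nodup (Multiset.nodup_range m)]
  simp

theorem count_residues {i : ℕ} (hi : i < 3) (z k : ℕ) :
    (residues i k).count z = if z % 3 = i ∧ z / 3 < k then 1 else 0 := by
  have hn : (residues i k).Nodup := Multiset.Nodup.map (fun a b h => by
    have h : 3 * a + i = 3 * b + i := h
    omega) (Multiset.nodup_range k)
  rw [Multiset.count_eq_of_nodup hn]
  congr 1
  simp only [residues, Multiset.mem_map, Multiset.mem_range, eq_iff_iff]
  exact ⟨by rintro ⟨w, hw, rfl⟩; omega, fun h => ⟨z / 3, by omega, by omega⟩⟩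

theorem residues_add {k₀ k₁ k₂ m : ℕ} (hm : m = k₀ + k₁ + k₂)
    (hk : k₂ ≤ k₁ ∧ k₁ ≤ k₀ ∧ k₀ ≤ k₂ + 1) :
    residues 0 k₀ + residues 1 k₁ + residues 2 k₂ = Multiset.range m := by
  ext z
  simp only [Multiset.count_add, count_residues (show 0 < 3 by decide),
    count_residues (show 1 < 3 by decide), count_residues (show 2 < 3 by decide), count_range]
  split_ifs <;> omega

theorem trail_range (y k : ℕ) : Trail y (Multiset.range (k + 1)) 0 k k 0 := by
  induction k with
  | zero => exact Trail.single 0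
  | succ k ih =>
    have := ih.snoc (i := 1) (j := 0) (k + 1) (Or.inl ⟨by omega, rfl, rfl⟩)
    rwa [← Multiset.range_succ] at this

theorem trail_residues (y i k : ℕ) : Trail y (residues i (k + 1)) i (3 * k + i) 0 k := by
  induction k with
  | zero => simpa [residues] using Trail.single (y := y) i
  | succ k ih =>
    have := ih.snoc (i := 0) (j := 1) (3 * (k + 1) + i) (Or.inr (Or.inl ⟨by omega, rfl, rfl⟩))
    unfold residues at this ⊢
    rw [Multiset.range_succ, Multiset.map_cons]
    exact this

/-- A trail from `0` with two steps of length `1` and otherwise steps of length `3`. -/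
theorem exists_trail_zero (y : ℕ) {m : ℕ} (hm : 3 ≤ m) :
    ∃ e, ((m % 3 = 0 ∧ e + 1 = m) ∨ (m % 3 ≠ 0 ∧ e + 3 = m)) ∧
      Trail y (Multiset.range m) 0 e 2 (m - 3) := by
  obtain ⟨k, hk | hk | hk⟩ : ∃ k, m = 3 * k + 3 ∨ m = 3 * k + 4 ∨ m = 3 * k + 5 :=
    ⟨m / 3 - 1, by omega⟩
  · have h := ((trail_residues y 0 k).append (i := 1) (j := 0) (trail_residues y 1 k).reverse
      (Or.inl ⟨by omega, rfl, rfl⟩)).append (i := 1) (j := 0) (trail_residues y 2 k)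
      (Or.inl ⟨by omega, rfl, rfl⟩)
    exact ⟨3 * k + 2, by omega, h.cast (residues_add (by omega) (by omega)) (by omega)⟩
  · have h := ((trail_residues y 0 (k + 1)).append (i := 1) (j := 0) (trail_residues y 2 k).reverse
      (Or.inl ⟨by omega, rfl, rfl⟩)).append (i := 1) (j := 0) (trail_residues y 1 k)
      (Or.inl ⟨by omega, rfl, rfl⟩)
    exact ⟨3 * k + 1, by omega, h.cast (by
      rw [add_right_comm]; exact residues_add (by omega) (by omega)) (by omega)⟩
  · have h := ((trail_residues y 0 (k + 1)).append (i := 1) (j := 0)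
      (trail_residues y 1 (k + 1)).reverse
      (Or.inl ⟨by omega, rfl, rfl⟩)).append (i := 1) (j := 0) (trail_residues y 2 k)
      (Or.inl ⟨by omega, rfl, rfl⟩)
    exact ⟨3 * k + 2, by omega, h.cast (residues_add (by omega) (by omega)) (by omega)⟩

/-- A trail from `0` to the largest element with two steps of length `1` and otherwise steps of
length `3`. -/
theorem exists_trail_zero_last (y : ℕ) {m : ℕ} (hm : 3 ≤ m) (hm' : m % 3 ≠ 1) :
    Trail y (Multiset.range m) 0 (m - 1) 2 (m - 3) := by
  obtain ⟨k, hk | hk⟩ : ∃ k, m = 3 * k + 3 ∨ m = 3 * k + 5 :=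
    ⟨m / 3 - 1, by omega⟩
  · have h := ((trail_residues y 0 k).append (i := 1) (j := 0) (trail_residues y 1 k).reverse
      (Or.inl ⟨by omega, rfl, rfl⟩)).append (i := 1) (j := 0) (trail_residues y 2 k)
      (Or.inl ⟨by omega, rfl, rfl⟩)
    exact h.cast (residues_add (by omega) (by omega)) (by omega)
  · have h := ((trail_residues y 0 (k + 1)).append (i := 1) (j := 0) (trail_residues y 2 k).reverse
      (Or.inl ⟨by omega, rfl, rfl⟩)).append (i := 1) (j := 0) (trail_residues y 1 (k + 1))
      (Or.inl ⟨by omega, rfl, rfl⟩)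
    exact h.cast (by
      rw [add_right_comm]; exact residues_add (by omega) (by omega)) (by omega)

/-- A trail from `2` with two steps of length `1` and otherwise steps of length `3`. -/
theorem exists_trail_two (y : ℕ) {m : ℕ} (hm : 3 ≤ m) :
    ∃ e, ((m % 3 = 0 ∧ e + 3 = m) ∨ (m % 3 ≠ 0 ∧ e + 1 = m)) ∧
      Trail y (Multiset.range m) 2 e 2 (m - 3) := by
  by_cases h0 : m % 3 = 0
  · obtain ⟨k, hk⟩ : ∃ k, m = 3 * k + 3 := ⟨m / 3 - 1, by omega⟩
    have h := ((trail_residues y 2 k).append (i := 1) (j := 0) (trail_residues y 1 k).reverse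
      (Or.inl ⟨by omega, rfl, rfl⟩)).append (i := 1) (j := 0) (trail_residues y 0 k)
      (Or.inl ⟨by omega, rfl, rfl⟩)
    refine ⟨3 * k, by omega, h.cast ?_ (by omega)⟩
    rw [← residues_add (k₀ := k + 1) (k₁ := k + 1) (k₂ := k + 1) (by omega) (by omega)]
    abel
  · obtain ⟨e, he, h⟩ := exists_trail_zero y hm
    exact ⟨m - 1, by omega, h.mirror.reverse.cast rfl (by omega)⟩

theorem exists_trail_zero_last' (y : ℕ) {m : ℕ} (hm : 4 ≤ m) (hm' : m % 3 = 1) :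
    Trail y (Multiset.range m) 0 (m - 1) 3 (m - 4) := by
  have h := (((exists_trail_zero_last y (m := m - 1) (by omega) (by omega)).onIco 1).one 0
    (by omega))
  refine h.cast ?_ (by omega)
  rw [range_eq_Ico, ← Multiset.Ico_add_Ico_eq_Ico (a := 0) (b := 1) (c := m) (by omega) (by omega),
    show 1 + (m - 1) = m by omega]
  rfl

end Intervals

section Grid

variable {y s k : ℕ} {x e α β i j : ℕ}

/-- A trail on `{0, …, n - 1}` starting at `0`. -/
def StdTrail (y n α β : ℕ) : Prop :=
  ∃ e, Trail y (Multiset.range n) 0 e α β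

theorem StdTrail.cast {n n' α' β' : ℕ} (h : StdTrail y n α β)
    (hn : n = n' ∧ α = α' ∧ β = β') : StdTrail y n' α' β' := by
  obtain ⟨rfl, rfl, rfl⟩ := hn
  exact h

theorem blow_grid (hs : s ≤ y) (q : ℕ) :
    blow y (q + 1) (Multiset.Ico 0 s) + blow y q (Multiset.Ico s y) =
      Multiset.range (q * y + s) := by
  induction q with
  | zero => simp [blow_one, blow_zero, range_eq_Ico]
  | succ q ih =>
    have h1 := blow_succ y (q + 1) (Multiset.Ico 0 s)
    have h2 := blow_succ y q (Multiset.Ico s y)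
    rw [Multiset.map_add_right_Ico] at h1 h2
    have h3 : blow y (q + 1 + 1) (Multiset.Ico 0 s) + blow y (q + 1) (Multiset.Ico s y) =
        (blow y (q + 1) (Multiset.Ico 0 s) + blow y q (Multiset.Ico s y)) +
        (Multiset.Ico (s + q * y) (y + q * y) +
          Multiset.Ico (0 + (q + 1) * y) (s + (q + 1) * y)) := by
      rw [h1, h2]; abel
    have h4 : (q + 1) * y = q * y + y := by ring
    rw [h3, ih, range_eq_Ico, range_eq_Ico, h4, zero_add, add_comm y,
      Multiset.Ico_add_Ico_eq_Ico (by omega) (by omega), add_comm s (q * y),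
      Multiset.Ico_add_Ico_eq_Ico (by omega) (by omega)]
    congr 1
    omega

theorem blow_grid' (hs : 1 ≤ s) (hs' : s ≤ y) (q : ℕ) :
    column y (q + 1) 0 + blow y q (Multiset.Ico s y) + blow y (q + 1) (Multiset.Ico 1 s) =
      Multiset.range (q * y + s) := by
  have h : ({0} : Multiset ℕ) + Multiset.Ico 1 s = Multiset.Ico 0 s := by
    rw [← Multiset.Ico_add_Ico_eq_Ico (a := 0) (b := 1) (c := s) (by omega) (by omega)]
    rfl
  rw [← blow_grid hs', ← h, blow_add, blow_singleton]
  abel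

theorem Trail.stdTrail_mul (h : Trail y (Multiset.range y) 0 e α β) (k : ℕ) :
    StdTrail y ((k + 1) * y) α β := by
  obtain ⟨⟨e', h'⟩, -⟩ := h.exists_blow k
  refine ⟨e', h'.cast ?_ (by simp)⟩
  have := blow_grid (le_refl y) k
  rw [Multiset.Ico_self, show blow y k 0 = 0 from rfl, add_zero, ← range_eq_Ico] at this
  rw [this]
  congr 1; ring

theorem Trail.stdTrail_mul_add_one (h : Trail y (Multiset.range y) 0 e α β) (k : ℕ) :
    StdTrail y ((k + 1) * y + 1) α β := by
  obtain ⟨-, e', h'⟩ := h.exists_blow k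
  have h1 := h'.long ((k + 1) * y) (Or.inr (by ring))
  have hset := blow_grid (le_refl y) k
  rw [Multiset.Ico_self, show blow y k 0 = 0 from rfl, add_zero, ← range_eq_Ico,
    show k * y + y = (k + 1) * y by ring] at hset
  rw [hset, ← Multiset.range_succ] at h1
  exact ⟨_, h1.mirror.cast rfl ⟨by simp, rfl, rfl, rfl⟩⟩

/-- The short columns come after the long ones. -/
theorem trail_two_blocks {e₁ x₂ e₂ α₁ β₁ α₂ β₂ : ℕ} (hs : s ≤ y) (hs' : Even s)
    (h₁ : Trail y (Multiset.range s) 0 e₁ α₁ β₁)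
    (h₂ : Trail y (Multiset.range (y - s)) x₂ e₂ α₂ β₂) (hstep : IsStep y e₁ (s + x₂) i j)
    (k : ℕ) : ∃ e, (Odd (y - s) → e = s + e₂ + k * y) ∧
      Trail y (Multiset.range ((k + 1) * y + s)) 0 e (α₁ + α₂ + i) (β₁ + β₂ + j) := by
  have g₁ := (h₁.blow_parity (k + 1)).1.2 (by simpa using hs')
  have g₂ := h₂.onIco s
  rw [show s + (y - s) = y by omega] at g₂
  have hset := blow_grid hs (k + 1)
  rw [← range_eq_Ico] at hset
  have hc : (Multiset.Ico s y).card = y - s := by simp [Multiset.Ico]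
  rcases Nat.even_or_odd (y - s) with hu | hu
  · have g₃ := (g₂.blow_parity k).1.2 (by rwa [hc])
    exact ⟨s + e₂, fun h => absurd hu (Nat.not_even_iff_odd.2 h),
      (g₁.append g₃ hstep).cast hset (by simp)⟩
  · have g₃ := (g₂.blow_parity k).1.1 (by rwa [hc])
    exact ⟨_, fun _ => rfl, (g₁.append g₃ hstep).cast hset (by simp)⟩

theorem trail_wrap_initial {x₂ e₂ α₂ β₂ : ℕ} (hk : Odd (y - s) ∨ k = 0)
    (h₂ : Trail y (Multiset.Ico s y) x₂ e₂ α₂ β₂) (hstep : IsStep y y x₂ i j) :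
    Trail y (column y (k + 2) 0 + blow y (k + 1) (Multiset.Ico s y)) 0 e₂ (α₂ + i) (β₂ + j) := by
  have hc : (Multiset.Ico s y).card = y - s := by simp [Multiset.Ico]
  have g₂ : Trail y (blow y (k + 1) (Multiset.Ico s y)) (x₂ + k * y) e₂ α₂ β₂ := by
    rcases hk with hk | rfl
    · exact (h₂.blow_parity k).2.1 (by rwa [hc])
    · simpa [blow_one] using h₂
  refine ((trail_column y (k + 1) 0).append g₂ (i := i) (j := j) ?_).cast rfl (by simp)
  convert hstep.add_right (k * y) using 1
  ring

/-- The first column is followed by the short columns and then by the remaining long columns. -/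
theorem trail_wrap {x₂ e₂ x₃ e₃ α₂ β₂ α₃ β₃ i' j' : ℕ} (hs : 1 ≤ s) (hs' : s ≤ y)
    (hk : Odd (y - s) ∨ k = 0)
    (h₂ : Trail y (Multiset.Ico s y) x₂ e₂ α₂ β₂) (hstep : IsStep y y x₂ i j)
    (h₃ : Trail y (Multiset.Ico 1 s) x₃ e₃ α₃ β₃) (hstep' : IsStep y e₂ x₃ i' j') :
    ∃ e, (Even s → e = e₃ + (k + 1) * y) ∧
      Trail y (Multiset.range ((k + 1) * y + s)) 0 e (α₂ + α₃ + i + i') (β₂ + β₃ + j + j') := by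
  have g₂ := trail_wrap_initial hk h₂ hstep
  have hc : (Multiset.Ico 1 s).card = s - 1 := by simp [Multiset.Ico]
  have hset := blow_grid' hs hs' (k + 1)
  rcases Nat.even_or_odd (s - 1) with hu | hu
  · have g₃ := (h₃.blow_parity (k + 1)).1.2 (by rwa [hc])
    refine ⟨e₃, fun h => ?_, (g₂.append g₃ hstep').cast hset (by omega)⟩
    rw [Nat.even_iff] at h hu; omega
  · have g₃ := (h₃.blow_parity (k + 1)).1.1 (by rwa [hc])
    exact ⟨_, fun _ => rfl, (g₂.append g₃ hstep').cast hset (by omega)⟩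

/-- As `trail_wrap`, with the last column `w` visited in the middle of the last but one. -/
theorem stdTrail_wrap_double {x₂ e₂ x₃ e₃ w α₂ β₂ α₃ β₃ i' j' i'' j'' : ℕ} {T : Multiset ℕ}
    (hs : 1 ≤ s) (hs' : s ≤ y) (hk : Odd (y - s) ∨ k = 0)
    (h₂ : Trail y (Multiset.Ico s y) x₂ e₂ α₂ β₂) (hstep : IsStep y y x₂ i j)
    (h₃ : Trail y T x₃ e₃ α₃ β₃) (hstep' : IsStep y e₂ x₃ i' j')
    (hT : w ::ₘ T = Multiset.Ico 1 s) (hw : IsStep y e₃ w i'' j'') :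
    StdTrail y ((k + 1) * y + s) (α₂ + α₃ + i + i' + 2 * i'') (β₂ + β₃ + j + j' + 2 * j'') := by
  obtain ⟨⟨e', g₃⟩, -⟩ := h₃.blow_double hw k
  have hset := blow_grid' hs hs' (k + 1)
  rw [← hT] at hset
  exact ⟨e', ((trail_wrap_initial hk h₂ hstep).append g₃ hstep').cast hset (by omega)⟩

theorem exists_stdTrail_wrap_double {x₂ e₂ x₃ e₃ α₂ β₂ α₃ β₃ i' j' : ℕ} (hs : 3 ≤ s) (hs' : s ≤ y)
    (hk : Odd (y - s) ∨ k = 0)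
    (h₂ : Trail y (Multiset.Ico s y) x₂ e₂ α₂ β₂) (hstep : IsStep y y x₂ i j)
    (h₃ : Trail y (Multiset.Ico 1 s) x₃ e₃ α₃ β₃) (hstep' : IsStep y e₂ x₃ i' j')
    (hc₃ : α₃ + β₃ + 2 = s) :
    ∃ i'' j'', i'' + j'' = 1 ∧ StdTrail y ((k + 1) * y + s)
      (α₂ + α₃ + i + i' + i'') (β₂ + β₃ + j + j' + j'') := by
  have hc : (Multiset.Ico 1 s).card = s - 1 := by simp [Multiset.Ico]
  obtain ⟨T, w, α', β', i'', j'', h, hw, hT, hij, rfl, rfl⟩ :=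
    h₃.exists_snoc (by omega) (by omega)
  exact ⟨i'', j'', hij,
    (stdTrail_wrap_double (by omega) hs' hk h₂ hstep h hstep' hT hw).cast (by omega)⟩

theorem StdTrail.extend {n : ℕ} (h : StdTrail y n α β) (a : ℕ) :
    StdTrail y (n + a) (α + a) β := by
  induction a with
  | zero => exact h
  | succ a ih =>
    obtain ⟨e, he⟩ := ih
    refine ⟨1 + e, ((he.onIco 1).one 0 (by omega)).cast ?_ (by omega)⟩
    rw [range_eq_Ico, ← Multiset.Ico_add_Ico_eq_Ico (a := 0) (b := 1) (c := n + (a + 1))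
      (by omega) (by omega), show 1 + (n + a) = n + (a + 1) by omega]
    rfl

/-- Two standard trails can be glued at their starting points. -/
theorem StdTrail.glue {n n' α' β' : ℕ} (h : StdTrail y n α β) (h' : StdTrail y (n' + 1) α' β') :
    ∃ x e, Trail y (Multiset.range (n + n')) x e (α + α') (β + β') := by
  obtain ⟨e, he⟩ := h
  obtain ⟨e', he'⟩ := h'
  have h0 := he.start_mem
  rw [Multiset.mem_range] at h0
  have h1 := he.mirror.reverse
  have h2 := he'.onIco (n - 1)
  have h3 : Multiset.Ico (n - 1) (n - 1 + (n' + 1)) =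
      (n - 1) ::ₘ Multiset.Ico n (n + n') := by
    rw [← Multiset.Ico_add_Ico_eq_Ico (a := n - 1) (b := n) (c := n - 1 + (n' + 1))
      (by omega) (by omega), ← Multiset.singleton_add]
    congr 1
    · obtain ⟨m, rfl⟩ : ∃ m, n = m + 1 := ⟨n - 1, by omega⟩
      simp [Multiset.Ico]
    · congr 1; omega
  rw [h3, add_zero] at h2
  refine ⟨_, _, (h1.join h2).cast ?_ ⟨rfl, rfl, rfl, rfl⟩⟩
  rw [range_eq_Ico, Multiset.Ico_add_Ico_eq_Ico (by omega) (by omega), ← range_eq_Ico]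

theorem stdTrail_three (y : ℕ) {a b : ℕ} (ha : 2 ≤ a) : StdTrail y (a + b + 1) a b := by
  obtain ⟨e, -, h⟩ := exists_trail_zero y (m := b + 3) (by omega)
  exact ((show StdTrail y (b + 3) 2 (b + 3 - 3) from ⟨e, h⟩).extend (a - 2)).cast (by omega)

end Grid

section Ones

variable {y : ℕ}

theorem Trail.toIco {x e α β a b x' e' m : ℕ} (h : Trail y (Multiset.range m) x e α β)
    (hm : a + m = b) (hx : a + x = x' ∧ a + e = e') : Trail y (Multiset.Ico a b) x' e' α β :=
  (h.onIco a).cast (by rw [hm]) (by omega)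

theorem Trail.toIco' {x e α β a b x' e' m : ℕ} (h : Trail y (Multiset.range m) x e α β)
    (hm : a + m = b) (hx : x + x' + 1 = b ∧ e + e' + 1 = b) :
    Trail y (Multiset.Ico a b) x' e' α β :=
  (h.mirrorIco a).cast (by rw [hm]) (by omega)

theorem trail_Ico_desc (y : ℕ) {a b : ℕ} (h : a < b) :
    Trail y (Multiset.Ico a b) (b - 1) a (b - 1 - a) 0 :=
  (trail_range y (b - 1 - a)).toIco' (by omega) (by omega)

theorem stdTrail_ones (hy : 2 ≤ y) (c : ℕ)
    (hc : Even (c % y) ∨ c % y = 1 ∨ Odd (y - c % y) ∨ c < y) :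
    StdTrail y (c + y) (y - 1) 0 := by
  have hs : c % y < y := Nat.mod_lt _ (by omega)
  have hcs : (c / y) * y + c % y = c := Nat.div_add_mod' c y
  have hk : c < y → c / y = 0 := Nat.div_eq_of_lt
  generalize c / y = k at *
  generalize c % y = s at *
  have hn : c + y = (k + 1) * y + s := by rw [← hcs]; ring
  rw [hn]
  have hall : Trail y (Multiset.range y) 0 (y - 1) (y - 1) 0 := by
    simpa [show y - 1 + 1 = y by omega] using trail_range y (y - 1)
  by_cases h0 : s = 0
  · subst h0; exact hall.stdTrail_mul k
  by_cases h1 : s = 1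
  · subst h1; exact hall.stdTrail_mul_add_one k
  rcases Nat.even_or_odd s with he | ho
  · have g₁ := trail_range y (s - 1)
    have g₂ := trail_range y (y - s - 1)
    rw [show s - 1 + 1 = s by omega] at g₁
    rw [show y - s - 1 + 1 = y - s by omega] at g₂
    obtain ⟨e, -, h⟩ := trail_two_blocks (i := 1) (j := 0) hs.le he g₁ g₂
      (Or.inl ⟨by omega, rfl, rfl⟩) k
    exact ⟨e, h.cast rfl (by omega)⟩
  · have hk' : Odd (y - s) ∨ k = 0 := by
      rcases hc with h | h | h | h
      · exact absurd h (Nat.not_even_iff_odd.2 ho)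
      · omega
      · exact Or.inl h
      · exact Or.inr (hk h)
    obtain ⟨e, -, h⟩ := trail_wrap (i := 1) (j := 0) (i' := 1) (j' := 0) (by omega) hs.le hk'
      (trail_Ico_desc y hs) (Or.inl ⟨by omega, rfl, rfl⟩) (trail_Ico_desc y (a := 1) (b := s)
      (by omega)) (Or.inl ⟨by omega, rfl, rfl⟩)
    exact ⟨e, h.cast rfl (by omega)⟩

/-- The data of the remaining case: one additional column is long. -/
theorem exists_grid {c : ℕ} (hy : 2 ≤ y)
    (hc : ¬ (Even (c % y) ∨ c % y = 1 ∨ Odd (y - c % y) ∨ c < y)) :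
    ∃ k s, Odd (y - s) ∧ Even s ∧ 4 ≤ s ∧ s < y ∧ s = c % y + 1 ∧ c + y + 1 = (k + 1) * y + s := by
  have hs : c % y < y := Nat.mod_lt _ (by omega)
  have hcs : (c / y) * y + c % y = c := Nat.div_add_mod' c y
  simp only [not_or, Nat.not_even_iff_odd, Nat.not_odd_iff_even, not_lt] at hc
  obtain ⟨h1, h2, h3, h4⟩ := hc
  rw [Nat.odd_iff] at h1
  rw [Nat.even_iff] at h3
  refine ⟨c / y, c % y + 1, Nat.odd_iff.2 (by omega), Nat.even_iff.2 (by omega), by omega,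
    by omega, rfl, ?_⟩
  nlinarith

theorem stdTrail_ones' (hy : 2 ≤ y) (c a : ℕ) (ha : y ≤ a) : StdTrail y (c + a + 1) a 0 := by
  by_cases hc : Even (c % y) ∨ c % y = 1 ∨ Odd (y - c % y) ∨ c < y
  · exact ((stdTrail_ones hy c hc).extend (a + 1 - y)).cast (by omega)
  · obtain ⟨k, s, hodd, -, hs, hs', -, hn⟩ := exists_grid hy hc
    have hT : 1 ::ₘ Multiset.Ico 2 s = Multiset.Ico 1 s := by
      rw [← Multiset.Ico_add_Ico_eq_Ico (a := 1) (b := 2) (c := s) (by omega) (by omega)]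
      rfl
    have h := stdTrail_wrap_double (k := k) (i := 1) (j := 0) (i' := 1) (j' := 0) (i'' := 1)
      (j'' := 0) (by omega) hs'.le (Or.inl hodd) (trail_Ico_desc y hs')
      (Or.inl ⟨by omega, rfl, rfl⟩) (trail_Ico_desc y (a := 2) (b := s) (by omega))
      (Or.inl ⟨by omega, rfl, rfl⟩) hT (Or.inl ⟨by omega, rfl, rfl⟩)
    exact (h.extend (a - y)).cast (by omega)

theorem stdTrail_ones_three {c : ℕ} (hy : 2 ≤ y)
    (hc : ¬ (Even (c % y) ∨ c % y = 1 ∨ Odd (y - c % y) ∨ c < y)) :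
    StdTrail y (c + y + 1) (y - 1) 1 := by
  obtain ⟨k, s, hodd, -, hs, hs', -, hn⟩ := exists_grid hy hc
  have h12 : Trail y (Multiset.Ico 1 3) 1 2 1 0 := by
    exact (trail_range y 1).toIco (a := 1) (by omega) (by omega)
  have hsplit : Multiset.Ico 1 s = Multiset.Ico 1 3 + ({3} + Multiset.Ico 4 s) := by
    rw [← Multiset.Ico_add_Ico_eq_Ico (a := 1) (b := 3) (c := s) (by omega) (by omega),
      ← Multiset.Ico_add_Ico_eq_Ico (a := 3) (b := 4) (c := s) (by omega) (by omega)]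
    rfl
  rw [hn]
  by_cases h4 : s = 4
  · subst h4
    have h := stdTrail_wrap_double (k := k) (i := 1) (j := 0) (i' := 0) (j' := 1) (i'' := 1)
      (j'' := 0) (w := 3) (by omega) hs'.le (Or.inl hodd) (trail_Ico_desc y hs')
      (Or.inl ⟨by omega, rfl, rfl⟩) h12
      (Or.inr (Or.inl ⟨by omega, rfl, rfl⟩))
      (by rw [hsplit, Multiset.Ico_self, ← Multiset.singleton_add]; abel)
      (Or.inl ⟨by omega, rfl, rfl⟩)
    exact h.cast (by omega)
  · have h := stdTrail_wrap_double (k := k) (i := 1) (j := 0) (i' := 1) (j' := 0) (i'' := 1)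
      (j'' := 0) (w := 3) (by omega) hs'.le (Or.inl hodd) (trail_Ico_desc y hs')
      (Or.inl ⟨by omega, rfl, rfl⟩)
      ((trail_Ico_desc y (a := 4) (b := s) (by omega)).append h12 (i := 0) (j := 1)
        (Or.inr (Or.inl ⟨by omega, rfl, rfl⟩)))
      (Or.inl ⟨by omega, rfl, rfl⟩)
      (by rw [hsplit, ← Multiset.singleton_add]; abel)
      (Or.inl ⟨by omega, rfl, rfl⟩)
    exact h.cast (by omega)

theorem hasLinearRealization_of_stdTrail {a b c n n' α β α' β' : ℕ} (h : StdTrail y n α β)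
    (h' : StdTrail y n' α' β')
    (hn : n + n' = a + b + c + 2 ∧ 1 ≤ n' ∧ α + α' = a ∧ β + β' = b) :
    HasLinearRealization (mset3 a b c 3 y) := by
  obtain ⟨m, rfl⟩ : ∃ m, n' = m + 1 := ⟨n' - 1, by omega⟩
  obtain ⟨x, e, ht⟩ := h.glue h'
  obtain ⟨hn, -, rfl, rfl⟩ := hn
  exact hasLinearRealization_of_trail (ht.cast (by congr 1; omega) ⟨rfl, rfl, rfl, rfl⟩)

theorem hasLinearRealization_of_ones {a b c : ℕ} (hy : 3 < y) (ha : y + 1 ≤ a) :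
    HasLinearRealization (mset3 a b c 3 y) := by
  by_cases hc : Even (c % y) ∨ c % y = 1 ∨ Odd (y - c % y) ∨ c < y
  · exact hasLinearRealization_of_stdTrail (stdTrail_ones (by omega) c hc)
      (stdTrail_three y (a := a + 1 - y) (b := b) (by omega)) (by omega)
  · rcases Nat.eq_zero_or_pos b with rfl | hb
    · obtain ⟨e, he⟩ := stdTrail_ones' (y := y) (by omega) c a (by omega)
      exact hasLinearRealization_of_trail (he.cast (by congr 1; omega) ⟨rfl, rfl, rfl, rfl⟩)
    · exact hasLinearRealization_of_stdTrail (stdTrail_ones_three (by omega) hc)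
        (stdTrail_three y (a := a + 1 - y) (b := b - 1) (by omega)) (by omega)

theorem hasLinearRealization_of_mod_le_one {a b c : ℕ} (hy : 3 < y) (ha : 4 ≤ a)
    (hab : y + 1 ≤ a + b) (hc : c % y = 0 ∨ c % y = 1) :
    HasLinearRealization (mset3 a b c 3 y) := by
  have hcs : (c / y) * y + c % y = c := Nat.div_add_mod' c y
  obtain ⟨e, h⟩ := stdTrail_three y (a := y - 1 - min b (y - 3)) (b := min b (y - 3)) (by omega)
  rw [show y - 1 - min b (y - 3) + min b (y - 3) + 1 = y by omega] at h
  have h₁ : StdTrail y (c + y) (y - 1 - min b (y - 3)) (min b (y - 3)) := by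
    rcases hc with hc | hc
    · refine (h.stdTrail_mul (c / y)).cast ⟨?_, rfl, rfl⟩
      nlinarith
    · refine (h.stdTrail_mul_add_one (c / y)).cast ⟨?_, rfl, rfl⟩
      nlinarith
  exact hasLinearRealization_of_stdTrail h₁ (stdTrail_three y
    (a := a - (y - 1 - min b (y - 3))) (b := b - min b (y - 3)) (by omega)) (by omega)

end Ones

section Mixed

variable {y : ℕ}

theorem exists_trail_zero_min (y : ℕ) {m : ℕ} (hm : 1 ≤ m) :
    ∃ e α β, α = min (m - 1) 2 ∧ α + β + 1 = m ∧ Trail y (Multiset.range m) 0 e α β := by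
  by_cases h3 : 3 ≤ m
  · obtain ⟨e, -, h⟩ := exists_trail_zero y h3
    exact ⟨e, 2, m - 3, by omega, by omega, h⟩
  · obtain rfl | rfl : m = 1 ∨ m = 2 := by omega
    · exact ⟨0, 0, 0, rfl, rfl, trail_range y 0⟩
    · exact ⟨1, 1, 0, rfl, rfl, trail_range y 1⟩

theorem exists_stdTrail_of_even {s : ℕ} (hy : 7 ≤ y) (hs : 2 ≤ s) (hsy : s < y) (he : Even s)
    (k : ℕ) : ∃ α β, 3 ≤ α ∧ α ≤ 5 ∧ α + β + 1 = y ∧ StdTrail y ((k + 1) * y + s) α β := by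
  have he' := Nat.even_iff.1 he
  have main : ∀ {e₁ x₂ e₂ α₁ β₁ α₂ β₂ i j : ℕ},
      Trail y (Multiset.range s) 0 e₁ α₁ β₁ → Trail y (Multiset.range (y - s)) x₂ e₂ α₂ β₂ →
      IsStep y e₁ (s + x₂) i j → 3 ≤ α₁ + α₂ + i ∧ α₁ + α₂ + i ≤ 5 ∧
        α₁ + α₂ + i + (β₁ + β₂ + j) + 1 = y →
      ∃ α β, 3 ≤ α ∧ α ≤ 5 ∧ α + β + 1 = y ∧ StdTrail y ((k + 1) * y + s) α β := by
    intro e₁ x₂ e₂ α₁ β₁ α₂ β₂ i j h₁ h₂ hstep h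
    obtain ⟨e, -, ht⟩ := trail_two_blocks hsy.le he h₁ h₂ hstep k
    exact ⟨_, _, h.1, h.2.1, h.2.2, e, ht⟩
  obtain ⟨e₂, α₂, β₂, hα₂, hβ₂, h₂⟩ := exists_trail_zero_min y (m := y - s) (by omega)
  by_cases h2 : s = 2
  · subst h2
    exact main (i := 1) (j := 0) (trail_range y 1) h₂ (Or.inl ⟨by omega, rfl, rfl⟩) (by omega)
  obtain ⟨e₁, he₁, h₁⟩ := exists_trail_zero y (m := s) (by omega)
  by_cases h0 : s % 3 = 0
  · by_cases hu : 3 ≤ y - s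
    · obtain ⟨e₃, -, h₃⟩ := exists_trail_two y hu
      exact main (i := 0) (j := 1) h₁ h₃ (Or.inr (Or.inl ⟨by omega, rfl, rfl⟩)) (by omega)
    · exact main (i := 1) (j := 0) h₁ h₂ (Or.inl ⟨by omega, rfl, rfl⟩) (by omega)
  by_cases hu : 2 ≤ y - s
  · exact main (i := 0) (j := 1) h₁ h₂ (Or.inr (Or.inl ⟨by omega, rfl, rfl⟩)) (by omega)
  by_cases h1 : s % 3 = 1
  · exact main (i := 1) (j := 0) (exists_trail_zero_last' y (by omega) h1) h₂
      (Or.inl ⟨by omega, rfl, rfl⟩) (by omega)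
  · exact main (i := 1) (j := 0) (exists_trail_zero_last y (by omega) h1) h₂
      (Or.inl ⟨by omega, rfl, rfl⟩) (by omega)

/-- A trail through the short columns that can be entered from the top of the first column and left
to the long columns. -/
theorem exists_trail_short_columns {s : ℕ} (hsy : s < y) (hu : y - s ≠ 2) :
    ∃ x e α β i j, Trail y (Multiset.Ico s y) x e α β ∧ IsStep y y x i j ∧
      ((y = s + 1 ∧ e = s ∧ α + i = 1 ∧ β + j = 0) ∨
        ((y - s) % 3 = 0 ∧ 3 ≤ y - s ∧ e = s + 2 ∧ α + i = 2 ∧ β + j + s + 2 = y) ∨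
        ((y - s) % 3 ≠ 0 ∧ 3 ≤ y - s ∧ e = s ∧ α + i = 2 ∧ β + j + s + 2 = y)) := by
  by_cases h1 : y = s + 1
  · exact ⟨y - 1, s, y - 1 - s, 0, 1, 0, trail_Ico_desc y hsy, Or.inl ⟨by omega, rfl, rfl⟩,
      by omega⟩
  · by_cases h0 : (y - s) % 3 = 0
    · obtain ⟨e, he, h⟩ := exists_trail_two y (m := y - s) (by omega)
      exact ⟨y - 3, s + 2, _, _, 0, 1, h.reverse.toIco (by omega) (by omega),
        Or.inr (Or.inl ⟨by omega, rfl, rfl⟩), by omega⟩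
    · obtain ⟨e, he, h⟩ := exists_trail_zero y (m := y - s) (by omega)
      exact ⟨y - 3, s, _, _, 0, 1, h.reverse.toIco (by omega) (by omega),
        Or.inr (Or.inl ⟨by omega, rfl, rfl⟩), by omega⟩

theorem exists_stdTrail_of_odd {s k : ℕ} (hs : 3 ≤ s) (hsy : s < y) (hy : 7 ≤ y)
    (hk : Odd (y - s) ∨ k = 0) :
    ∃ α β, 3 ≤ α ∧ α ≤ 5 ∧ α + β + 1 = y ∧ StdTrail y ((k + 1) * y + s) α β := by
  have main : ∀ {x₂ e₂ x₃ e₃ α₂ β₂ α₃ β₃ i j i' j' : ℕ},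
      Trail y (Multiset.Ico s y) x₂ e₂ α₂ β₂ → IsStep y y x₂ i j →
      Trail y (Multiset.Ico 1 s) x₃ e₃ α₃ β₃ → IsStep y e₂ x₃ i' j' →
      3 ≤ α₂ + α₃ + i + i' ∧ α₂ + α₃ + i + i' ≤ 5 ∧
        α₂ + α₃ + i + i' + (β₂ + β₃ + j + j') + 1 = y →
      ∃ α β, 3 ≤ α ∧ α ≤ 5 ∧ α + β + 1 = y ∧ StdTrail y ((k + 1) * y + s) α β := by
    intro x₂ e₂ x₃ e₃ α₂ β₂ α₃ β₃ i j i' j' h₂ hstep h₃ hstep' h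
    obtain ⟨e, -, ht⟩ := trail_wrap (by omega) hsy.le hk h₂ hstep h₃ hstep'
    exact ⟨_, _, h.1, h.2.1, h.2.2, e, ht⟩
  obtain ⟨e₃, α₃, β₃, hα₃, hβ₃, h₃⟩ := exists_trail_zero_min y (m := s - 1) (by omega)
  have he₃ := h₃.reverse.start_mem
  rw [Multiset.mem_range] at he₃
  have g₃ : Trail y (Multiset.Ico 1 s) (s - 1) (s - 1 - e₃) α₃ β₃ :=
    h₃.toIco' (by omega) (by omega)
  by_cases hu : y - s = 2
  · exact main (i := 1) (j := 0) (i' := 1) (j' := 0) (trail_Ico_desc y hsy)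
      (Or.inl ⟨by omega, rfl, rfl⟩) g₃ (Or.inl ⟨by omega, rfl, rfl⟩) (by omega)
  obtain ⟨x₂, e₂, α₂, β₂, i, j, h₂, hstep, h | h | h⟩ := exists_trail_short_columns hsy hu
  · exact main (i' := 1) (j' := 0) h₂ hstep g₃ (Or.inl ⟨by omega, rfl, rfl⟩) (by omega)
  · exact main (i' := 0) (j' := 1) h₂ hstep g₃ (Or.inr (Or.inl ⟨by omega, rfl, rfl⟩)) (by omega)
  · by_cases h3 : 4 ≤ s
    · obtain ⟨e₄, he₄, h₄⟩ := exists_trail_two y (m := s - 1) (by omega)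
      exact main (i' := 0) (j' := 1) h₂ hstep
        (h₄.toIco' (a := 1) (x' := s - 3) (e' := s - 1 - e₄) (by omega) (by omega))
        (Or.inr (Or.inl ⟨by omega, rfl, rfl⟩)) (by omega)
    · exact main (i' := 1) (j' := 0) h₂ hstep g₃ (Or.inl ⟨by omega, rfl, rfl⟩) (by omega)

theorem exists_stdTrail_of_odd' {s k : ℕ} (hs : 4 ≤ s) (hsy : s < y)
    (hk : Odd (y - s)) :
    ∃ α β, 4 ≤ α ∧ α ≤ 5 ∧ α + β = y ∧ StdTrail y ((k + 1) * y + s) α β := by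
  have hk' := Nat.odd_iff.1 hk
  have main : ∀ {x₂ e₂ x₃ e₃ α₂ β₂ α₃ β₃ i j i' j' : ℕ},
      Trail y (Multiset.Ico s y) x₂ e₂ α₂ β₂ → IsStep y y x₂ i j →
      Trail y (Multiset.Ico 1 s) x₃ e₃ α₃ β₃ → IsStep y e₂ x₃ i' j' →
      α₃ + β₃ + 2 = s ∧ α₂ + α₃ + i + i' = 4 ∧
        α₂ + α₃ + i + i' + (β₂ + β₃ + j + j') + 1 = y →
      ∃ α β, 4 ≤ α ∧ α ≤ 5 ∧ α + β = y ∧ StdTrail y ((k + 1) * y + s) α β := by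
    intro x₂ e₂ x₃ e₃ α₂ β₂ α₃ β₃ i j i' j' h₂ hstep h₃ hstep' h
    obtain ⟨i'', j'', hij, ht⟩ := exists_stdTrail_wrap_double (k := k) (by omega) hsy.le
      (Or.inl hk) h₂ hstep h₃ hstep' h.1
    exact ⟨_, _, by omega, by omega, by omega, ht⟩
  obtain ⟨e₃, he₃, h₃⟩ := exists_trail_zero y (m := s - 1) (by omega)
  have g₃ : Trail y (Multiset.Ico 1 s) (s - 1) (s - 1 - e₃) 2 (s - 1 - 3) :=
    h₃.toIco' (by omega) (by omega)
  obtain ⟨x₂, e₂, α₂, β₂, i, j, h₂, hstep, h | h | h⟩ :=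
    exists_trail_short_columns hsy (by omega)
  · exact main (i' := 1) (j' := 0) h₂ hstep g₃ (Or.inl ⟨by omega, rfl, rfl⟩) (by omega)
  · exact main (i' := 0) (j' := 1) h₂ hstep g₃ (Or.inr (Or.inl ⟨by omega, rfl, rfl⟩)) (by omega)
  · obtain ⟨e₄, he₄, h₄⟩ := exists_trail_two y (m := s - 1) (by omega)
    exact main (i' := 0) (j' := 1) h₂ hstep
      (h₄.toIco' (a := 1) (x' := s - 3) (e' := s - 1 - e₄) (by omega) (by omega))
      (Or.inr (Or.inl ⟨by omega, rfl, rfl⟩)) (by omega)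

theorem exists_stdTrail_few_ones {c : ℕ} (hy : 7 ≤ y) (hc : 2 ≤ c % y) :
    ∃ α β, α ≤ 5 ∧ β + 4 ≤ y ∧ StdTrail y (c + α + β + 1) α β := by
  by_cases hc' : Even (c % y) ∨ c % y = 1 ∨ Odd (y - c % y) ∨ c < y
  · have hs : c % y < y := Nat.mod_lt _ (by omega)
    have hcs : (c / y) * y + c % y = c := Nat.div_add_mod' c y
    have hk : c < y → c / y = 0 := Nat.div_eq_of_lt
    have hn : c + y = (c / y + 1) * y + c % y := by nlinarith
    have : ∃ α β, 3 ≤ α ∧ α ≤ 5 ∧ α + β + 1 = y ∧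
        StdTrail y ((c / y + 1) * y + c % y) α β := by
      rcases Nat.even_or_odd (c % y) with he | ho
      · exact exists_stdTrail_of_even hy hc hs he _
      · have ho' := Nat.odd_iff.1 ho
        refine exists_stdTrail_of_odd (by omega) hs hy ?_
        rcases hc' with h | h | h | h
        · exact absurd h (Nat.not_even_iff_odd.2 ho)
        · omega
        · exact Or.inl h
        · exact Or.inr (hk h)
    obtain ⟨α, β, h₁, h₂, h₃, h⟩ := this
    exact ⟨α, β, h₂, by omega, h.cast (by omega)⟩
  · obtain ⟨k, s, hodd, -, hs, hs', -, hn⟩ := exists_grid (by omega) hc'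
    obtain ⟨α, β, h₁, h₂, h₃, h⟩ := exists_stdTrail_of_odd' (k := k) hs hs' hodd
    exact ⟨α, β, h₂, by omega, h.cast (by omega)⟩

theorem hasLinearRealization_of_seven_le {a b c : ℕ} (hy : 3 < y) (ha : 7 ≤ a)
    (hb : y - 4 ≤ b) : HasLinearRealization (mset3 a b c 3 y) := by
  by_cases h1 : y + 1 ≤ a
  · exact hasLinearRealization_of_ones hy h1
  by_cases h2 : 2 ≤ c % y
  · obtain ⟨α, β, hα, hβ, h⟩ := exists_stdTrail_few_ones (c := c) (by omega) h2
    exact hasLinearRealization_of_stdTrail h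
      (stdTrail_three y (a := a - α) (b := b - β) (by omega)) (by omega)
  · exact hasLinearRealization_of_mod_le_one hy (by omega) (by omega) (by omega)

end Mixed

section Dilated

variable {t : ℕ}

theorem Trail.toResidues {x e α n : ℕ} (h : Trail t (Multiset.range n) x e α 0) (i : ℕ) :
    Trail (3 * t) (residues i n) (3 * x + i) (3 * e + i) 0 α :=
  h.dilate i

theorem stdTrail_two_of_classes {p p' e b₁ b₂ : ℕ}
    (h₁ : Trail t (Multiset.range p) 0 e b₁ 0) (h₂ : StdTrail t p' b₂ 0)
    (hp : p' ≤ p ∧ p ≤ p' + 1) : StdTrail (3 * t) (2 * p + p') 2 (2 * b₁ + b₂) := by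
  obtain ⟨e', h₂⟩ := h₂
  have h := ((h₁.toResidues 0).append (i := 1) (j := 0) (h₁.toResidues 1).reverse
    (Or.inl ⟨by omega, rfl, rfl⟩)).append (i := 1) (j := 0) (h₂.toResidues 2)
    (Or.inl ⟨by omega, rfl, rfl⟩)
  exact ⟨_, h.cast (residues_add (by omega) (by omega)) ⟨rfl, rfl, by omega, by omega⟩⟩

theorem exists_trail_two_of_classes {q e b₁ b₂ : ℕ}
    (h₁ : Trail t (Multiset.range q) 0 e b₁ 0) (h₂ : StdTrail t (q + 1) b₂ 0) :
    ∃ x e, Trail (3 * t) (Multiset.range (3 * q + 1)) x e 2 (2 * b₁ + b₂) := by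
  obtain ⟨e', h₂⟩ := h₂
  have h := ((h₂.toResidues 0).reverse.append (i := 1) (j := 0) (h₁.toResidues 1)
    (Or.inl ⟨by omega, rfl, rfl⟩)).append (i := 1) (j := 0) (h₁.toResidues 2).reverse
    (Or.inl ⟨by omega, rfl, rfl⟩)
  exact ⟨_, _, h.cast (residues_add (by omega) (by omega)) ⟨rfl, rfl, by omega, by omega⟩⟩

theorem stdTrail_three_of_classes {q e b₁ b₂ b₃ : ℕ}
    (h₁ : Trail t (Multiset.range (q + 1)) 0 (e + 1) b₁ 0)
    (h₂ : Trail t (Multiset.range q) 0 e b₂ 0) (h₃ : StdTrail t q b₃ 0) :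
    StdTrail (3 * t) (3 * q + 2) 3 (b₁ + b₂ + b₃) := by
  obtain ⟨e', h₃⟩ := h₃
  have h := (((h₁.toResidues 1).append (i := 1) (j := 0) ((h₂.onIco 1).dilate 0).reverse
    (Or.inl ⟨by omega, rfl, rfl⟩)).append (i := 1) (j := 0) (h₃.toResidues 2)
    (Or.inl ⟨by omega, rfl, rfl⟩)).one 0 (by omega)
  refine ⟨_, h.cast ?_ ⟨rfl, rfl, by omega, by omega⟩⟩
  have h0 : residues 0 (q + 1) = 0 ::ₘ (Multiset.Ico 1 (1 + q)).map (3 * · + 0) := by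
    rw [residues, range_eq_Ico,
      ← Multiset.Ico_add_Ico_eq_Ico (a := 0) (b := 1) (c := q + 1) (by omega) (by omega),
      add_comm q 1, Multiset.map_add]
    rfl
  rw [← residues_add (k₀ := q + 1) (k₁ := q + 1) (k₂ := q) (by omega) (by omega), h0,
    ← Multiset.singleton_add, ← Multiset.singleton_add]
  abel

theorem exists_trail_ones (ht : 2 ≤ t) {n b : ℕ} (hb : t ≤ b) (hn : b + 1 ≤ n) :
    StdTrail t n b 0 :=
  (stdTrail_ones' ht (n - b - 1) b hb).cast (by omega)

theorem Trail.prepend {y n e α β : ℕ} (h : Trail y (Multiset.range n) 0 e α β) :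
    Trail y (Multiset.range (n + 1)) 0 (e + 1) (α + 1) β := by
  refine ((h.onIco 1).one 0 (by omega)).cast ?_ (by omega)
  rw [range_eq_Ico, ← Multiset.Ico_add_Ico_eq_Ico (a := 0) (b := 1) (c := n + 1)
    (by omega) (by omega), add_comm n 1]
  rfl

theorem stdTrail_three_of_classes_eq (ht : 2 ≤ t) {q : ℕ} (hq : t + 2 ≤ q) :
    StdTrail (3 * t) (3 * q + 2) 3 (3 * t) := by
  have hr : StdTrail t q (t + 1) 0 := exists_trail_ones ht (by omega) (by omega)
  by_cases hc : Even ((q - t) % t) ∨ (q - t) % t = 1 ∨ Odd (t - (q - t) % t) ∨ q - t < t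
  · obtain ⟨e, h⟩ := (stdTrail_ones ht (q - t) hc).cast (n' := q) ⟨by omega, rfl, rfl⟩
    exact (stdTrail_three_of_classes h.prepend h hr).cast (by omega)
  · obtain ⟨k, s, hodd, heven, hs, hs', -, hn⟩ := exists_grid ht hc
    obtain ⟨e₁, he₁, h₁⟩ := trail_wrap (k := k) (i := 1) (j := 0) (i' := 1) (j' := 0) (by omega)
      hs'.le (Or.inl hodd) (trail_Ico_desc t hs') (Or.inl ⟨by omega, rfl, rfl⟩)
      (trail_Ico_desc t (a := 1) (b := s) (by omega)) (Or.inl ⟨by omega, rfl, rfl⟩)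
    have heven' := Nat.even_iff.1 heven
    have hodd' := Nat.odd_iff.1 hodd
    have g₁ := trail_range t (s - 2 - 1)
    have g₂ := trail_range t (t - (s - 2) - 1)
    rw [show s - 2 - 1 + 1 = s - 2 by omega] at g₁
    rw [show t - (s - 2) - 1 + 1 = t - (s - 2) by omega] at g₂
    obtain ⟨e₂, he₂, h₂⟩ := trail_two_blocks (i := 1) (j := 0) (by omega)
      (Nat.even_iff.2 (by omega)) g₁ g₂ (Or.inl ⟨by omega, rfl, rfl⟩) k
    have he₁' := he₁ heven
    have he₂' := he₂ (Nat.odd_iff.2 (by omega))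
    have hk : (k + 1) * t = k * t + t := by ring
    have h₃ := h₂.prepend
    have hq₁ : (k + 1) * t + s = q + 1 := by omega
    have hq₂ : (k + 1) * t + (s - 2) + 1 = q := by omega
    rw [hq₁, show e₁ = (e₂ + 1) + 1 by omega] at h₁
    rw [hq₂] at h₃
    refine (stdTrail_three_of_classes (h₁.cast rfl ⟨rfl, rfl, rfl, by omega⟩)
      (h₃.cast rfl ⟨rfl, rfl, rfl, by omega⟩) hr).cast (by omega)

theorem StdTrail.hasLinearRealization {y a b c n : ℕ} (h : StdTrail y n a b)
    (hn : n = a + b + c + 1) : HasLinearRealization (mset3 a b c 3 y) := by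
  obtain ⟨e, h⟩ := h
  exact hasLinearRealization_of_trail (h.cast (by rw [hn]) ⟨rfl, rfl, rfl, rfl⟩)

theorem hasLinearRealization_of_three_dvd {a b c : ℕ} (ht : 2 ≤ t) (ha : 2 ≤ a) (hb : 3 * t ≤ b)
    (hv : c ≠ 0 → 6 * t ≤ a + b + c + 1) : HasLinearRealization (mset3 a b c 3 (3 * t)) := by
  by_cases hc : c = 0
  · exact (stdTrail_three (3 * t) ha (b := b)).hasLinearRealization (by omega)
  by_cases ha' : 7 ≤ a
  · exact hasLinearRealization_of_seven_le (by omega) ha' (by omega)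
  by_cases hac : 4 ≤ a ∧ c = 1
  · exact hasLinearRealization_of_mod_le_one (by omega) (by omega) (by omega)
      (Or.inr (by rw [hac.2]; exact Nat.mod_eq_of_lt (by omega)))
  by_cases hex : t = 2 ∧ a = 3 ∧ b = 7 ∧ c = 1
  · obtain ⟨rfl, rfl, rfl, rfl⟩ := hex
    exact ⟨[0, 1, 4, 7, 10, 11, 8, 5, 2, 3, 9, 6], by decide, by decide⟩
  have hv := hv hc
  obtain ⟨q, r, hr, hqr⟩ : ∃ q r, r < 3 ∧ b + c + 3 = 3 * q + r :=
    ⟨(b + c + 3) / 3, (b + c + 3) % 3, by omega, by omega⟩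
  by_cases hr1 : r = 1
  · subst hr1
    by_cases ha2 : a = 2
    · obtain ⟨b₁, hb₁⟩ : ∃ b₁, b₁ = min (q - 1) ((b - t) / 2) := ⟨_, rfl⟩
      obtain ⟨e, h₁⟩ := exists_trail_ones ht (n := q) (b := b₁) (by omega) (by omega)
      obtain ⟨x, e', h⟩ := exists_trail_two_of_classes h₁
        (exists_trail_ones ht (n := q + 1) (b := b - 2 * b₁) (by omega) (by omega))
      exact hasLinearRealization_of_trail
        (h.cast (by congr 1; omega) ⟨rfl, rfl, by omega, by omega⟩)
    by_cases hb' : b = 3 * t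
    · subst hb'
      exact ((stdTrail_three_of_classes_eq ht (q := q)
        (by omega)).extend (a - 3)).cast (α' := a) (by omega) |>.hasLinearRealization rfl
    · obtain ⟨b₁, hb₁⟩ : ∃ b₁, b₁ = min (q - 1) ((b - 1 - t) / 2) := ⟨_, rfl⟩
      obtain ⟨e, h₁⟩ := exists_trail_ones ht (n := q) (b := b₁) (by omega) (by omega)
      have h := stdTrail_three_of_classes h₁.prepend h₁
        (exists_trail_ones ht (n := q) (b := b - 1 - 2 * b₁) (by omega) (by omega))
      exact ((h.extend (a - 3)).cast (α' := a) (β' := b) (by omega)).hasLinearRealization rfl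
  · obtain ⟨p, p', hp⟩ : ∃ p p', (r = 0 ∧ p = q ∧ p' = q) ∨ (r = 2 ∧ p = q + 1 ∧ p' = q) := by
      rcases Nat.eq_zero_or_pos r with h | h
      · exact ⟨q, q, by omega⟩
      · exact ⟨q + 1, q, by omega⟩
    obtain ⟨b₁, hb₁⟩ : ∃ b₁, b₁ = min (p - 1) ((b - t) / 2) := ⟨_, rfl⟩
    obtain ⟨e, h₁⟩ := exists_trail_ones ht (n := p) (b := b₁) (by omega) (by omega)
    have h := stdTrail_two_of_classes h₁
      (exists_trail_ones ht (n := p') (b := b - 2 * b₁) (by omega) (by omega)) (by omega)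
    exact ((h.extend (a - 2)).cast (α' := a) (β' := b) (by omega)).hasLinearRealization rfl

end Dilated

/-- Applications to `x = 3`. Let `L = {1^a, 3^b, y^c}` be an
admissible multiset of size `v - 1` with `y > 3`, where `v = a + b + c + 1` and
`r = v % 3`. Then `L` has a linear realization in each of the four listed
cases. -/
theorem stmt16 (a b c y v : ℕ) (hy : 3 < y) (hv : v = a + b + c + 1)
    (hadm : IsAdmissible v (mset3 a b c 3 y))
    (hcase :
      (y + 1 ≤ a) ∨
      (7 ≤ a ∧ y - 4 ≤ b) ∨
      (4 ≤ a ∧ y + 1 ≤ a + b ∧ (c % y = 0 ∨ c % y = 1)) ∨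
      (2 ≤ a ∧ ∃ t : ℕ, y = 3 * t ∧ 3 * t + 6 ≤ v ∧
        ((Even (v % 3) ∧ 3 * t ≤ b) ∨ (Odd (v % 3) ∧ 3 * t + 1 ≤ b)))) :
    HasLinearRealization (mset3 a b c 3 y) := by
  rcases hcase with h | ⟨h, h'⟩ | ⟨h, h', h''⟩ | ⟨h, t, rfl, -, h'⟩
  · exact hasLinearRealization_of_ones hy h
  · exact hasLinearRealization_of_seven_le hy h h'
  · exact hasLinearRealization_of_mod_le_one hy h h' h''
  · refine hasLinearRealization_of_three_dvd (by omega) h (by omega) fun hc => ?_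
    have hmem := (hadm.2.1 (3 * t) (by simp [mset3, Multiset.mem_replicate, hc])).2
    omega
end
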